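/- arXiv:2106.09673 — 2 statements merged into one kernel-verified Lean document; each statement's English description precedes it below -/
import Mathlib

section
/- Let Γ be a countably infinite group and let F ⊂ Γ be a nonempty finite symmetric set with 1 ∉ F. If ℓ ≥ |F| + 1, then there exists a free subshift S ⊆ Col(F, ℓ) such that every free Borel action of Γ on a Polish space X admits a Borel Γ-equivariant map X → S. -/
open scoped Pointwise
section ShiftDefs

variable {Γ : Type} [Group Γ] {A B : Type*}

/-- The Bernoulli shift action of `Γ`: `(γ · x)(δ) = x(δγ)`. -/
def shiftAct (γ : Γ) (x : Γ → A) : Γ → A := fun δ => x (δ * γ)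

/-- The free part of the shift `Γ ↷ (Γ → A)`. -/
def freePart (Γ : Type) [Group Γ] (A : Type*) : Set (Γ → A) :=
  {x | ∀ γ : Γ, shiftAct γ x = x → γ = 1}

/-- A subshift: a closed shift-invariant subset. -/
def IsSubshift [TopologicalSpace A] (S : Set (Γ → A)) : Prop :=
  IsClosed S ∧ ∀ γ : Γ, ∀ x ∈ S, shiftAct γ x ∈ S

/-- A subshift of finite type: `⋂ γ (γ · C)` for some clopen `C`. -/
def IsSFT [TopologicalSpace A] (S : Set (Γ → A)) : Prop :=
  ∃ C : Set (Γ → A), IsClopen C ∧ S = ⋂ γ : Γ, shiftAct γ ⁻¹' C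

/-- The stabilizer of a point under the shift action. -/
def ptStab (x : Γ → A) : Set Γ := {γ | shiftAct γ x = x}

/-- `Stab(π)`: elements fixing every point in the image of `π` (domain `dom`). -/
def mapStab (π : (Γ → A) → (Γ → B)) (dom : Set (Γ → A)) : Set Γ :=
  {γ | ∀ x ∈ dom, shiftAct γ (π x) = π x}

/-- `Γ`-equivariance of `π` on the set `dom`. -/
def EquivariantOn (π : (Γ → A) → (Γ → B)) (dom : Set (Γ → A)) : Prop :=
  ∀ x ∈ dom, ∀ γ : Γ, π (shiftAct γ x) = shiftAct γ (π x)

/-- `Col(F, ℓ)`: proper `ℓ`-colorings of the Cayley graph `G(Γ, F)`. -/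
def properCol (F : Finset Γ) (ℓ : ℕ) : Set (Γ → Fin ℓ) :=
  {x | ∀ γ : Γ, ∀ σ ∈ F, x γ ≠ x (σ * γ)}

end ShiftDefs

section DiscreteMeasurability

variable {X α β : Type*} [MeasurableSpace X]

/-- Measurability of a map into a set of values with the discrete σ-algebra. -/
def DMeas (f : X → α) : Prop := ∀ s : Set α, MeasurableSet (f ⁻¹' s)

theorem DMeas.of_fiber [Countable α] {f : X → α} (h : ∀ a, MeasurableSet {x | f x = a}) :
    DMeas f := by
  intro s
  have : f ⁻¹' s = ⋃ a ∈ s, {x | f x = a} := by ext x; simp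
  rw [this]
  exact MeasurableSet.biUnion s.to_countable fun a _ => h a

theorem DMeas.fiber {f : X → α} (h : DMeas f) (a : α) : MeasurableSet {x | f x = a} := h {a}

theorem DMeas.comp {f : X → α} (h : DMeas f) (g : α → β) : DMeas (fun x => g (f x)) :=
  fun s => h (g ⁻¹' s)

theorem DMeas.const (a : α) : DMeas (fun _ : X => a) := fun s => by
  by_cases h : a ∈ s <;> simp [h]

theorem DMeas.pi {ι : Type*} [Finite ι] [Countable α] {f : ι → X → α} (h : ∀ i, DMeas (f i)) :
    DMeas (fun x i => f i x) := by
  refine DMeas.of_fiber fun a => ?_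
  have : {x | (fun i => f i x) = a} = ⋂ i, {x | f i x = a i} := by
    ext x; simp [funext_iff]
  rw [this]
  exact MeasurableSet.iInter fun i => (h i).fiber (a i)

theorem DMeas.prodMk [Countable α] [Countable β] {f : X → α} {g : X → β} (hf : DMeas f)
    (hg : DMeas g) : DMeas (fun x => (f x, g x)) := by
  refine DMeas.of_fiber fun a => ?_
  have : {x | (f x, g x) = a} = {x | f x = a.1} ∩ {x | g x = a.2} := by
    ext x; simp [Prod.ext_iff]
  rw [this]
  exact (hf.fiber _).inter (hg.fiber _)

theorem DMeas.comp₂ [Countable α] [Countable β] {δ : Type*} {f : X → α} {g : X → β}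
    (hf : DMeas f) (hg : DMeas g) (k : α → β → δ) : DMeas (fun x => k (f x) (g x)) :=
  (hf.prodMk hg).comp fun p => k p.1 p.2

theorem DMeas.bind [Countable α] [Countable β] {κ : X → α} (hκ : DMeas κ) {f : α → X → β}
    (hf : ∀ a, DMeas (f a)) : DMeas (fun x => f (κ x) x) := by
  refine DMeas.of_fiber fun b => ?_
  have : {x | f (κ x) x = b} = ⋃ a, ({x | κ x = a} ∩ {x | f a x = b}) := by
    ext x; simp
  rw [this]
  exact MeasurableSet.iUnion fun a => (hκ.fiber a).inter ((hf a).fiber b)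

theorem DMeas.ite [Countable α] {p : X → Prop} [DecidablePred p] {f g : X → α} (hp : DMeas p)
    (hf : DMeas f) (hg : DMeas g) : DMeas (fun x => if p x then f x else g x) := by
  classical
  have := hp.comp₂ (hf.prodMk hg) fun (q : Prop) (r : α × α) => if q then r.1 else r.2
  convert this

theorem DMeas.exists {ι : Type*} [Countable ι] {p : ι → X → Prop} (h : ∀ i, DMeas (p i)) :
    DMeas (fun x => ∃ i, p i x) := by
  have h1 : MeasurableSet {x | ∃ i, p i x} := by
    rw [Set.ofPred_exists]
    refine MeasurableSet.iUnion fun i => ?_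
    simpa using (h i).fiber True
  refine DMeas.of_fiber fun a => ?_
  by_cases ha : a
  · simpa [ha] using h1
  · simpa [ha, Set.compl_ofPred] using h1.compl

theorem DMeas.and {p q : X → Prop} (hp : DMeas p) (hq : DMeas q) :
    DMeas (fun x => p x ∧ q x) := hp.comp₂ hq And

theorem DMeas.not {p : X → Prop} (hp : DMeas p) : DMeas (fun x => ¬ p x) := hp.comp Not

theorem DMeas.or {p q : X → Prop} (hp : DMeas p) (hq : DMeas q) :
    DMeas (fun x => p x ∨ q x) := hp.comp₂ hq Or

end DiscreteMeasurability

section FreeBorel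

/-- A free action by measurable maps such that the Schreier graph of every finite set
has a measurable proper coloring with countably many colors. -/
structure IsFreeBorel (Γ X : Type*) [Group Γ] [MulAction Γ X] [MeasurableSpace X] : Prop where
  meas : ∀ γ : Γ, Measurable fun x : X => γ • x
  free : ∀ (γ : Γ) (x : X), γ • x = x → γ = 1
  sep : ∀ K : Finset Γ, ∃ κ : X → ℕ, DMeas κ ∧ ∀ k ∈ K, k ≠ 1 → ∀ x, κ (k • x) ≠ κ x

/-- Proper colorings of the Schreier graph of `F`. -/
def SchreierProper {Γ X α : Type*} [Group Γ] [MulAction Γ X] (F : Finset Γ) (c : X → α) : Prop :=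
  ∀ x, ∀ σ ∈ F, c x ≠ c (σ • x)

theorem isFreeBorel_of_polish {Γ X : Type*} [Group Γ] [MulAction Γ X] [TopologicalSpace X]
    [PolishSpace X] [MeasurableSpace X] [BorelSpace X]
    (meas : ∀ γ : Γ, Measurable fun x : X => γ • x)
    (free : ∀ (γ : Γ) (x : X), γ • x = x → γ = 1) : IsFreeBorel Γ X := by
  classical
  refine ⟨meas, free, fun K => ?_⟩
  rcases isEmpty_or_nonempty X with hX | hX
  · exact ⟨fun _ => 0, DMeas.const 0, fun _ _ _ x => hX.elim x⟩
  obtain ⟨b, hbc, -, hb⟩ := TopologicalSpace.exists_countable_basis X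
  have hbne : b.Nonempty := by
    obtain ⟨x⟩ := hX
    obtain ⟨u, hu, -⟩ := hb.exists_subset_of_mem_open (Set.mem_univ x) isOpen_univ
    exact ⟨u, hu⟩
  obtain ⟨U, hU⟩ := hbc.exists_eq_range hbne
  have hUo : ∀ n, IsOpen (U n) := fun n => hb.isOpen (hU ▸ Set.mem_range_self n)
  have key : ∀ x : X, ∃ n, x ∈ U n ∧ ∀ k ∈ K, k ≠ 1 → k • x ∉ U n := by
    intro x
    have hfin : (((K.erase 1).image fun k => k • x : Finset X) : Set X).Finite :=
      Finset.finite_toSet _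
    have hx : x ∈ (((K.erase 1).image fun k => k • x : Finset X) : Set X)ᶜ := by
      simp only [Set.mem_compl_iff, Finset.mem_coe, Finset.mem_image, Finset.mem_erase, not_exists,
        not_and]
      rintro k ⟨hk, -⟩ h
      exact hk (free k x h)
    obtain ⟨u, hu, hxu, hsub⟩ := hb.exists_subset_of_mem_open hx hfin.isClosed.isOpen_compl
    rw [hU] at hu
    obtain ⟨n, rfl⟩ := hu
    refine ⟨n, hxu, fun k hk hk1 hmem => hsub hmem ?_⟩
    simp only [Finset.mem_coe, Finset.mem_image, Finset.mem_erase]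
    exact ⟨k, ⟨hk1, hk⟩, rfl⟩
  refine ⟨fun x => Nat.find (key x), ?_, ?_⟩
  · refine DMeas.of_fiber fun n => ?_
    have hP : ∀ n, MeasurableSet {x | x ∈ U n ∧ ∀ k ∈ K, k ≠ 1 → k • x ∉ U n} := by
      intro n
      have : {x | x ∈ U n ∧ ∀ k ∈ K, k ≠ 1 → k • x ∉ U n} =
          U n ∩ ⋂ k ∈ K.erase 1, ((fun x => k • x) ⁻¹' (U n))ᶜ := by
        ext x
        simp only [Set.mem_ofPred_eq, Set.mem_inter_iff, Set.mem_iInter, Finset.mem_erase,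
          Set.mem_compl_iff, Set.mem_preimage, and_imp]
        tauto
      rw [this]
      exact (hUo n).measurableSet.inter (Finset.measurableSet_biInter _ fun k _ =>
        (meas k (hUo n).measurableSet).compl)
    have : {x | Nat.find (key x) = n} = {x | x ∈ U n ∧ ∀ k ∈ K, k ≠ 1 → k • x ∉ U n} ∩
        ⋂ m ∈ Finset.range n, {x | x ∈ U m ∧ ∀ k ∈ K, k ≠ 1 → k • x ∉ U m}ᶜ := by
      ext x
      simp only [Set.mem_ofPred_eq, Nat.find_eq_iff, Set.mem_inter_iff, Set.mem_iInter,
        Finset.mem_range, Set.mem_compl_iff]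
    rw [this]
    exact (hP n).inter (Finset.measurableSet_biInter _ fun m _ => (hP m).compl)
  · intro k hk hk1 x h
    have h1 := (Nat.find_spec (key (k • x))).1
    have h2 := (Nat.find_spec (key x)).2 k hk hk1
    dsimp only at h
    rw [h] at h1
    exact h2 h1

variable {Γ X : Type*} [Group Γ] [MulAction Γ X] [MeasurableSpace X]

theorem IsFreeBorel.dmeas_smul (hX : IsFreeBorel Γ X) {α : Type*} {f : X → α} (hf : DMeas f)
    (γ : Γ) : DMeas (fun x => f (γ • x)) := fun s => hX.meas γ (hf s)

theorem IsFreeBorel.inj (hX : IsFreeBorel Γ X) {γ δ : Γ} {x : X} (h : γ • x = δ • x) : γ = δ := by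
  have := hX.free (δ⁻¹ * γ) x (by rw [mul_smul, h, inv_smul_smul])
  rwa [inv_mul_eq_one, eq_comm] at this

/-- Measurable greedy recursion along a countable coloring. -/
theorem IsFreeBorel.exists_greedy (hX : IsFreeBorel Γ X) (K : Finset Γ) {T : Type*} [Countable T]
    (Ψ : X → (K → Option T) → T) (hΨ : ∀ v, DMeas fun x => Ψ x v) :
    ∃ (κ : X → ℕ) (f : X → T), (∀ k ∈ K, k ≠ 1 → ∀ x, κ (k • x) ≠ κ x) ∧ DMeas f ∧
      ∀ x, f x = Ψ x fun k => if κ (k.1 • x) < κ x then some (f (k.1 • x)) else none := by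
  obtain ⟨κ, hκ, hsep⟩ := hX.sep K
  let G : ℕ → X → T := fun n => Nat.rec (fun x => Ψ x fun _ => none)
    (fun n g x => if κ x = n then
      Ψ x (fun k => if κ (k.1 • x) < n then some (g (k.1 • x)) else none) else g x) n
  have hG : ∀ n x, G (n + 1) x = if κ x = n then
      Ψ x (fun k => if κ (k.1 • x) < n then some (G n (k.1 • x)) else none) else G n x :=
    fun _ _ => rfl
  have hstab : ∀ n x, κ x < n → G n x = G (κ x + 1) x := by
    intro n x hn
    induction n, hn using Nat.le_induction with
    | base => rfl
    | succ n hn ih => rw [hG, if_neg (by omega), ih]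
  have hmeas : ∀ n, DMeas (G n) := by
    intro n
    induction n with
    | zero => exact hΨ _
    | succ n ih =>
      refine DMeas.ite (hκ.comp fun m => m = n) ?_ ih
      refine DMeas.bind (f := fun v x => Ψ x v) (DMeas.pi fun k => ?_) hΨ
      exact DMeas.ite ((hX.dmeas_smul hκ k.1).comp fun m => m < n)
        ((hX.dmeas_smul ih k.1).comp some) (DMeas.const none)
  refine ⟨κ, fun x => G (κ x + 1) x, hsep, hκ.bind fun n => hmeas (n + 1), fun x => ?_⟩
  dsimp only
  rw [hG, if_pos rfl]
  congr 1
  funext k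
  split_ifs with h
  · rw [hstab _ _ h]
  · rfl

/-- A partial measurable proper coloring with more than `|F|` colors extends. -/
theorem IsFreeBorel.exists_extend (hX : IsFreeBorel Γ X) {F : Finset Γ}
    (hFsym : ∀ σ ∈ F, σ⁻¹ ∈ F) (hF1 : (1 : Γ) ∉ F) {ℓ : ℕ} (hℓ : F.card + 1 ≤ ℓ)
    {U : X → Prop} (hU : DMeas U) {c : X → Fin ℓ} (hc : DMeas c)
    (hprop : ∀ x, ∀ σ ∈ F, ¬ U x → ¬ U (σ • x) → c x ≠ c (σ • x)) :
    ∃ c' : X → Fin ℓ, DMeas c' ∧ SchreierProper F c' ∧ ∀ x, ¬ U x → c' x = c x := by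
  classical
  have hpick : ∀ w : F → Option (Fin ℓ), ∃ a, ∀ k, w k ≠ some a := by
    intro w
    by_contra! h
    choose k hk using h
    have hinj : Function.Injective k := by
      intro a b hab
      have := hk a
      rw [hab, hk b] at this
      exact (Option.some_injective _ this).symm
    have := Fintype.card_le_of_injective k hinj
    simp at this
    omega
  choose pick hpick using hpick
  obtain ⟨κ, f, hκ, hf, hfe⟩ := hX.exists_greedy F
    (fun x v => if U x then pick (fun k => if U (k.1 • x) then v k else some (c (k.1 • x)))
      else c x) (by
      intro v
      refine DMeas.ite hU ?_ hc
      refine DMeas.comp (DMeas.pi fun k => ?_) pick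
      exact DMeas.ite (hX.dmeas_smul hU k.1) (DMeas.const _) ((hX.dmeas_smul hc k.1).comp some))
  have hoff : ∀ x, ¬ U x → f x = c x := fun x hx => by rw [hfe, if_neg hx]
  have hkey : ∀ x, ∀ σ ∈ F, U x → (U (σ • x) → κ (σ • x) < κ x) → f x ≠ f (σ • x) := by
    intro x σ hσ hx hlt heq
    have h1 := hfe x
    rw [if_pos hx] at h1
    have h2 := hpick (fun k => if U (k.1 • x) then
      (if κ (k.1 • x) < κ x then some (f (k.1 • x)) else none) else some (c (k.1 • x))) ⟨σ, hσ⟩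
    rw [← h1] at h2
    dsimp only at h2
    by_cases hσx : U (σ • x)
    · rw [if_pos hσx, if_pos (hlt hσx)] at h2
      exact h2 (by rw [heq])
    · rw [if_neg hσx, ← hoff _ hσx] at h2
      exact h2 (by rw [heq])
  refine ⟨f, hf, ?_, hoff⟩
  intro x σ hσ heq
  have hσ' := hFsym σ hσ
  by_cases hx : U x
  · by_cases hσx : U (σ • x)
    · have hne := hκ σ hσ (fun h => hF1 (h ▸ hσ)) x
      rcases lt_or_gt_of_ne hne with h | h
      · exact hkey x σ hσ hx (fun _ => h) heq
      · refine hkey (σ • x) σ⁻¹ hσ' hσx (fun _ => ?_) ?_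
        · rwa [inv_smul_smul]
        · rw [inv_smul_smul, heq]
    · exact hkey x σ hσ hx (fun h => absurd h hσx) heq
  · by_cases hσx : U (σ • x)
    · refine hkey (σ • x) σ⁻¹ hσ' hσx (fun h => ?_) ?_
      · rw [inv_smul_smul] at h; exact absurd h hx
      · rw [inv_smul_smul, heq]
    · rw [hoff x hx, hoff _ hσx] at heq
      exact hprop x σ hσ hx hσx heq

/-- Finite measurable colorings of Schreier graphs. -/
theorem IsFreeBorel.exists_coloring (hX : IsFreeBorel Γ X) (K : Finset Γ) :
    ∃ (Q : ℕ) (κ : X → ℕ), DMeas κ ∧ (∀ x, κ x < Q) ∧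
      ∀ k ∈ K, k ≠ 1 → ∀ x, κ (k • x) ≠ κ x := by
  classical
  let F : Finset Γ := (K ∪ K⁻¹).erase 1
  obtain ⟨c, hc, hp, -⟩ := hX.exists_extend (F := F) (ℓ := F.card + 1)
    (fun σ hσ => by
      simp only [F, Finset.mem_erase, Finset.mem_union, Finset.mem_inv', inv_inv] at hσ ⊢
      exact ⟨inv_ne_one.2 hσ.1, hσ.2.symm⟩)
    (by simp [F]) le_rfl (DMeas.const True) (DMeas.const (0 : Fin (F.card + 1)))
    (by simp)
  refine ⟨F.card + 1, fun x => c x, hc.comp _, fun x => (c x).2, fun k hk hk1 x h => ?_⟩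
  exact hp x k (by simp [F, hk, hk1]) (Fin.ext h.symm)

/-- Maximal discrete measurable sets. -/
theorem IsFreeBorel.exists_maximal (hX : IsFreeBorel Γ X) (R : Finset Γ)
    (hRsym : ∀ r ∈ R, r⁻¹ ∈ R) (hR1 : 1 ∈ R) :
    ∃ M : X → Prop, DMeas M ∧ (∀ x, ∀ r ∈ R, M x → M (r • x) → r = 1) ∧
      ∀ x, ∃ r ∈ R, M (r • x) := by
  classical
  obtain ⟨κ, M, hκ, hM, hMe⟩ := hX.exists_greedy R
    (fun _ v => ∀ k, k.1 ≠ 1 → v k ≠ some True) (fun v => DMeas.const _)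
  have hlt : ∀ x, ∀ r ∈ R, r ≠ 1 → M x → κ (r • x) < κ x → ¬ M (r • x) := by
    intro x r hr hr1 hx hlt hrx
    rw [hMe x] at hx
    have := hx ⟨r, hr⟩ hr1
    simp [hlt, hrx] at this
  refine ⟨M, hM, ?_, ?_⟩
  · intro x r hr hx hrx
    by_contra hr1
    rcases lt_or_gt_of_ne (hκ r hr hr1 x) with h | h
    · exact hlt x r hr hr1 hx h hrx
    · exact hlt (r • x) r⁻¹ (hRsym r hr) (inv_ne_one.2 hr1) hrx (by rwa [inv_smul_smul])
        (by rwa [inv_smul_smul])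
  · intro x
    by_cases hx : M x
    · exact ⟨1, hR1, by rwa [one_smul]⟩
    · rw [hMe x] at hx
      push Not at hx
      obtain ⟨k, -, hk⟩ := hx
      refine ⟨k.1, k.2, ?_⟩
      split_ifs at hk with h
      have := Option.some_injective _ hk
      rw [this]; trivial

end FreeBorel

section GroupCombinatorics

/-- A sequence avoiding, at each term, a finite set determined by the earlier terms. -/
theorem exists_seq_avoiding {α : Type*} [Infinite α] [DecidableEq α]
    (Bad : Finset α → Finset α) (hmono : Monotone Bad) :
    ∃ h : ℕ → α, ∀ n, ∀ s : Finset α, (∀ a ∈ s, ∃ m < n, a = h m) → h n ∉ Bad s := by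
  choose next hnext using fun s : Finset α => Infinite.exists_notMem_finset (Bad s)
  let S : ℕ → Finset α := fun n => Nat.rec ∅ (fun _ s => insert (next s) s) n
  have hS : ∀ n, S (n + 1) = insert (next (S n)) (S n) := fun _ => rfl
  have hmem : ∀ n, ∀ m < n, next (S m) ∈ S n := by
    intro n
    induction n with
    | zero => intro m hm; omega
    | succ n ih =>
      intro m hm
      rw [hS]
      rcases Nat.lt_succ_iff_lt_or_eq.1 hm with h | rfl
      · exact Finset.mem_insert_of_mem (ih m h)
      · exact Finset.mem_insert_self _ _
  refine ⟨fun n => next (S n), fun n s hs h => hnext (S n) (hmono ?_ h)⟩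
  intro a ha
  obtain ⟨m, hm, rfl⟩ := hs a ha
  exact hmem n m hm

variable {Γ : Type*} [Group Γ]

/-- Finite families of elements in general position relative to a finite set. -/
theorem exists_generic_family [Infinite Γ] [DecidableEq Γ] (ι : Type*) [Finite ι] (B : Finset Γ) :
    ∃ h : ι → Γ, (∀ i j, i ≠ j → ∀ b ∈ B, h j ≠ b * h i) ∧
      ∀ (e : Γ) (S : Finset ι), (∀ i ∈ S, ∃ j, j ≠ i ∧ ∃ b ∈ B, h i * e = b * h j) →
        S.card ≤ 2 := by
  classical
  let B' : Finset Γ := B ∪ B⁻¹ ∪ {1}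
  let D : Finset Γ := B' * B'
  have h1 : (1 : Γ) ∈ B' := by simp [B']
  have hB : ∀ b ∈ B, b ∈ B' := fun b hb => by simp [B', hb]
  have hBi : ∀ b ∈ B, b⁻¹ ∈ B' := fun b hb => by simp [B', hb]
  have hD : ∀ b ∈ B', b ∈ D := fun b hb => Finset.mem_mul.2 ⟨b, hb, 1, h1, mul_one b⟩
  obtain ⟨h, hh⟩ := exists_seq_avoiding (fun P : Finset Γ => D * P * P⁻¹ * D * P) (by
    intro P Q hPQ
    have : P⁻¹ ⊆ Q⁻¹ := Finset.inv_subset_inv hPQ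
    dsimp only
    gcongr)
  have avoid : ∀ n i j k, i < n → j < n → k < n → ∀ g ∈ D, ∀ g' ∈ D,
      h n ≠ g * h i * (h j)⁻¹ * g' * h k := by
    intro n i j k hi hj hk g hg g' hg' heq
    refine hh n {h i, h j, h k} ?_ ?_
    · intro a ha
      simp only [Finset.mem_insert, Finset.mem_singleton] at ha
      rcases ha with rfl | rfl | rfl
      exacts [⟨i, hi, rfl⟩, ⟨j, hj, rfl⟩, ⟨k, hk, rfl⟩]
    · rw [heq]
      refine Finset.mul_mem_mul (Finset.mul_mem_mul (Finset.mul_mem_mul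
        (Finset.mul_mem_mul hg ?_) (Finset.inv_mem_inv ?_)) hg') ?_ <;> simp
  have spread : ∀ i j, i ≠ j → ∀ d ∈ D, d⁻¹ ∈ D → h j ≠ d * h i := by
    intro i j hij d hd hd' heq
    rcases lt_or_gt_of_ne hij with hlt | hlt
    · exact avoid j i i i hlt hlt hlt d hd 1 (hD 1 h1) (by rw [heq]; group)
    · exact avoid i j j j hlt hlt hlt d⁻¹ hd' 1 (hD 1 h1) (by rw [heq]; group)
  have sidon : ∀ e i j i' j' b b', i ≠ j → b ∈ B → b' ∈ B →
      h i * e = b * h j → h i' * e = b' * h j' → max i' j' < max i j → False := by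
    intro e i j i' j' b b' hij hb hb' he he' hlt
    have hee : (h i)⁻¹ * b * h j = (h i')⁻¹ * b' * h j' := by
      rw [mul_assoc, ← he, mul_assoc, ← he']; group
    obtain ⟨hi', hj'⟩ := max_lt_iff.1 hlt
    rcases lt_or_gt_of_ne hij with h2 | h2
    · rw [max_eq_right h2.le] at hi' hj'
      refine avoid j i i' j' h2 hi' hj' b⁻¹ (hD _ (hBi b hb)) b' (hD _ (hB b' hb')) ?_
      have : h j = b⁻¹ * h i * ((h i)⁻¹ * b * h j) := by group
      rw [this, hee]; group
    · rw [max_eq_left h2.le] at hi' hj'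
      refine avoid i j j' i' h2 hj' hi' b (hD _ (hB b hb)) b'⁻¹ (hD _ (hBi b' hb')) ?_
      have : h i = b * h j * ((h i)⁻¹ * b * h j)⁻¹ := by group
      rw [this, hee]; group
  have same : ∀ e i i' j b b', i ≠ i' → b ∈ B → b' ∈ B →
      h i * e = b * h j → h i' * e = b' * h j → False := by
    intro e i i' j b b' hii hb hb' he he'
    refine spread i i' hii (b' * b⁻¹) (Finset.mul_mem_mul (hB b' hb') (hBi b hb)) ?_ ?_
    · rw [mul_inv_rev, inv_inv]
      exact Finset.mul_mem_mul (hB b hb) (hBi b' hb')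
    · have e1 : h j = b⁻¹ * (h i * e) := by rw [he]; group
      have e2 : h i' = b' * h j * e⁻¹ := by rw [← he']; group
      rw [e2, e1]; group
  obtain ⟨n, ⟨φ⟩⟩ := Finite.exists_equiv_fin ι
  have hφ : Function.Injective fun i => (φ i : ℕ) := Fin.val_injective.comp φ.injective
  refine ⟨fun i => h (φ i), fun i j hij b hb => ?_, fun e S hS => ?_⟩
  · exact spread _ _ (hφ.ne hij) b (hD _ (hB b hb)) (hD _ (hBi b hb))
  · by_contra! hcard
    obtain ⟨i₁, h₁, i₂, h₂, i₃, h₃, h12, h13, h23⟩ := Finset.two_lt_card.1 hcard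
    obtain ⟨j₁, hj₁, b₁, hb₁, he₁⟩ := hS i₁ h₁
    obtain ⟨j₂, hj₂, b₂, hb₂, he₂⟩ := hS i₂ h₂
    obtain ⟨j₃, hj₃, b₃, hb₃, he₃⟩ := hS i₃ h₃
    have n12 := hφ.ne h12
    have n13 := hφ.ne h13
    have n23 := hφ.ne h23
    have m₁ := hφ.ne hj₁
    have m₂ := hφ.ne hj₂
    have m₃ := hφ.ne hj₃
    dsimp only at *
    have a12 := sidon e _ _ _ _ _ _ m₁.symm hb₁ hb₂ he₁ he₂
    have a21 := sidon e _ _ _ _ _ _ m₂.symm hb₂ hb₁ he₂ he₁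
    have a13 := sidon e _ _ _ _ _ _ m₁.symm hb₁ hb₃ he₁ he₃
    have a31 := sidon e _ _ _ _ _ _ m₃.symm hb₃ hb₁ he₃ he₁
    have b12 := same e _ _ _ b₁ b₂ n12 hb₁ hb₂ he₁
    have b13 := same e _ _ _ b₁ b₃ n13 hb₁ hb₃ he₁
    have b23 := same e _ _ _ b₂ b₃ n23 hb₂ hb₃ he₂
    have c12 : (φ j₁ : ℕ) ≠ φ j₂ := fun hc => b12 (hc ▸ he₂)
    have c13 : (φ j₁ : ℕ) ≠ φ j₃ := fun hc => b13 (hc ▸ he₃)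
    have c23 : (φ j₂ : ℕ) ≠ φ j₃ := fun hc => b23 (hc ▸ he₃)
    have d12 : ¬ max (φ i₂ : ℕ) (φ j₂) < max (φ i₁ : ℕ) (φ j₁) := a12
    have d21 : ¬ max (φ i₁ : ℕ) (φ j₁) < max (φ i₂ : ℕ) (φ j₂) := a21
    have d13 : ¬ max (φ i₃ : ℕ) (φ j₃) < max (φ i₁ : ℕ) (φ j₁) := a13
    have d31 : ¬ max (φ i₁ : ℕ) (φ j₁) < max (φ i₃ : ℕ) (φ j₃) := a31
    clear a12 a21 a13 a31 b12 b13 b23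
    omega

/-- If `|E| < 2 ^ t`, a single choice of bits on `t` blocks of length `2 * k` differs from each
of the patterns indexed by `E` in at least `k` positions of some block. -/
theorem exists_block_bits {ε α : Type*} [DecidableEq α] (E : Finset ε) {t k : ℕ}
    (hE : E.card < 2 ^ t) (col : Bool → α) (hcol : col false ≠ col true)
    (p : ε → Fin t × Fin (2 * k) → α) :
    ∃ b : Fin t → Bool, ∀ e ∈ E, ∃ i,
      k ≤ (Finset.univ.filter fun s => p e (i, s) ≠ col (b i)).card := by
  by_contra! h
  choose e he hbad using h
  have hinj : Function.Injective e := by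
    intro b b' hbb
    by_contra hne
    obtain ⟨i, hi⟩ := Function.ne_iff.1 hne
    have h1 := hbad b i
    have h2 := hbad b' i
    rw [hbb] at h1
    have hcc : col (b i) ≠ col (b' i) := by
      cases hb : b i <;> cases hb' : b' i <;> simp_all
      exact fun h => hcol h.symm
    have hun : (Finset.univ : Finset (Fin (2 * k))) =
        (Finset.univ.filter fun s => p (e b') (i, s) ≠ col (b i)) ∪
        (Finset.univ.filter fun s => p (e b') (i, s) ≠ col (b' i)) := by
      ext s
      simp only [Finset.mem_univ, Finset.mem_union, Finset.mem_filter, true_and, true_iff]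
      by_contra! h3
      exact hcc (h3.1.symm.trans h3.2)
    have := congrArg Finset.card hun
    have h3 := Finset.card_union_le
      (Finset.univ.filter fun s => p (e b') (i, s) ≠ col (b i))
      (Finset.univ.filter fun s => p (e b') (i, s) ≠ col (b' i))
    rw [← this, Finset.card_univ, Fintype.card_fin] at h3
    omega
  have hle := Finset.card_le_card_of_injOn (s := Finset.univ) (t := E) e (fun b _ => he b)
    hinj.injOn
  simp at hle
  omega

theorem exists_pow_lt_two_pow (a d : ℕ) : ∃ t : ℕ, 0 < t ∧ a * t ^ d < 2 ^ t := by
  have h := tendsto_pow_const_div_const_pow_of_one_lt d (one_lt_two : (1 : ℝ) < 2)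
  have h2 := h.eventually (gt_mem_nhds (show (0 : ℝ) < 1 / (a + 1) by positivity))
  obtain ⟨t, ht, ht0⟩ := (h2.and (Filter.eventually_gt_atTop 0)).exists
  refine ⟨t, ht0, ?_⟩
  rw [div_lt_div_iff₀ (by positivity) (by positivity)] at ht
  have : (a : ℝ) * t ^ d < 2 ^ t := by
    have : (0 : ℝ) ≤ (t : ℝ) ^ d := by positivity
    linarith
  exact_mod_cast this

end GroupCombinatorics

section Recoloring

/-- Finite data steering one stage of recoloring: around a marker `m` the recolored points have
the form `c • h i • m` with `c ∈ C`. -/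
structure IsGadget {Γ ι : Type*} [Group Γ] (F C B A : Finset Γ) (h : ι → Γ) : Prop where
  one_mem : 1 ∈ B
  inv_mem : ∀ b ∈ B, b⁻¹ ∈ B
  subset : F ⊆ B
  mem_support : ∀ i, ∀ c ∈ C, c * h i ∈ A
  spread : ∀ i j, i ≠ j → ∀ c ∈ C, ∀ c' ∈ C, ∀ b ∈ B, c' * h j ≠ b * (c * h i)
  sidon : ∀ (e : Γ) (S : Finset ι),
    (∀ i ∈ S, ∃ j, j ≠ i ∧ ∃ c ∈ C, ∃ c' ∈ C, ∃ b ∈ B, c * h i * e = b * (c' * h j)) → S.card ≤ 2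

/-- The interaction range of a gadget. -/
def interaction {Γ : Type*} [Group Γ] [DecidableEq Γ] (A B : Finset Γ) : Finset Γ := A⁻¹ * B * A

variable {Γ X ι : Type*} [Group Γ] [MulAction Γ X]

theorem mem_interaction [DecidableEq Γ] {A B : Finset Γ} {a a' b : Γ} (ha : a ∈ A) (hb : b ∈ B)
    (ha' : a' ∈ A) : a⁻¹ * b * a' ∈ interaction A B :=
  Finset.mul_mem_mul (Finset.mul_mem_mul (Finset.inv_mem_inv ha) hb) ha'

theorem inv_mem_interaction [DecidableEq Γ] {A B : Finset Γ} (hB : ∀ b ∈ B, b⁻¹ ∈ B) {u : Γ}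
    (hu : u ∈ interaction A B) : u⁻¹ ∈ interaction A B := by
  simp only [interaction, Finset.mem_mul, Finset.mem_inv'] at hu
  obtain ⟨_, ⟨a, ha, b, hb, rfl⟩, a', ha', rfl⟩ := hu
  have := mem_interaction ha' (hB b hb) ha
  convert this using 1
  group

theorem one_mem_interaction [DecidableEq Γ] {A B : Finset Γ} (hB : 1 ∈ B) (hA : A.Nonempty) :
    1 ∈ interaction A B := by
  obtain ⟨a, ha⟩ := hA
  simpa using mem_interaction ha hB ha

/-- The position of the `i`-th recolored point of a marker. -/
def gadgetPos (sel : X → Γ) (h : ι → Γ) (i : ι) (m : X) : Γ := sel (h i • m) * h i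

/-- The set of all recolored points of the markers satisfying `P`. -/
def gadgetPoints (sel : X → Γ) (h : ι → Γ) (P : X → Prop) (y : X) : Prop :=
  ∃ m i, P m ∧ y = gadgetPos sel h i m • m

/-- The union of the translates of a set by the elements of a finite set. -/
def zone (K : Finset Γ) (Y : X → Prop) (z : X) : Prop := ∃ f ∈ K, ∃ y, Y y ∧ z = f • y

theorem zone.mono {K : Finset Γ} {Y Y' : X → Prop} (hYY : ∀ y, Y y → Y' y) {z : X}
    (hz : zone K Y z) : zone K Y' z := by
  obtain ⟨f, hf, y, hy, rfl⟩ := hz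
  exact ⟨f, hf, y, hYY y hy, rfl⟩

theorem IsGadget.pos_mem {F C B A : Finset Γ} {h : ι → Γ} (hG : IsGadget F C B A h) {sel : X → Γ}
    (hsel : ∀ x, sel x ∈ C) (i : ι) (m : X) : gadgetPos sel h i m ∈ A :=
  hG.mem_support i _ (hsel _)

theorem IsGadget.range_mem [DecidableEq Γ] {F C B A : Finset Γ} {h : ι → Γ}
    (hG : IsGadget F C B A h) {f : Γ} (hf : f ∈ insert 1 F) : f ∈ B := by
  rcases Finset.mem_insert.1 hf with rfl | hf
  exacts [hG.one_mem, hG.subset hf]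

variable [MeasurableSpace X]

theorem IsGadget.pos_inj [DecidableEq Γ] (hX : IsFreeBorel Γ X) {F C B A : Finset Γ} {h : ι → Γ}
    (hG : IsGadget F C B A h) {sel : X → Γ} (hsel : ∀ x, sel x ∈ C) {M : X → Prop}
    (hM : ∀ x, ∀ r ∈ interaction A B * interaction A B, M x → M (r • x) → r = 1)
    {m m' : X} (hm : M m) (hm' : M m') {i j : ι} {b : Γ} (hb : b ∈ B)
    (heq : gadgetPos sel h i m • m = b • gadgetPos sel h j m' • m') : m = m' ∧ i = j ∧ b = 1 := by
  have ha := hG.pos_mem hsel i m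
  have ha' := hG.pos_mem hsel j m'
  have h1 : m = ((gadgetPos sel h i m)⁻¹ * b * gadgetPos sel h j m') • m' := by
    rw [mul_smul, mul_smul, ← heq, inv_smul_smul]
  have hu := mem_interaction ha hb ha'
  have h1J := one_mem_interaction hG.one_mem ⟨_, ha⟩
  have h2 := hM m' _ (by simpa using Finset.mul_mem_mul hu h1J) hm' (h1 ▸ hm)
  rw [h2, one_smul] at h1
  subst h1
  have h3 : gadgetPos sel h i m = b * gadgetPos sel h j m := by
    rw [← mul_smul] at heq
    exact hX.inj heq
  have hij : i = j := by
    by_contra hij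
    exact hG.spread j i (Ne.symm hij) _ (hsel _) _ (hsel _) b hb h3
  subst hij
  exact ⟨rfl, rfl, by simpa using h3⟩

theorem dmeas_gadgetPoints [Countable Γ] [Finite ι] (hX : IsFreeBorel Γ X)
    {sel : X → Γ} (hselm : DMeas sel) (h : ι → Γ) {P : X → Prop} (hP : DMeas P) :
    DMeas (gadgetPoints sel h P) := by
  have : gadgetPoints sel h P = fun y => ∃ (i : ι) (γ : Γ), P (γ⁻¹ • y) ∧
      sel (h i • γ⁻¹ • y) * h i = γ := by
    funext y
    refine propext ⟨?_, ?_⟩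
    · rintro ⟨m, i, hm, rfl⟩
      exact ⟨i, gadgetPos sel h i m, by rwa [inv_smul_smul], by rw [inv_smul_smul]; rfl⟩
    · rintro ⟨i, γ, hP, hγ⟩
      refine ⟨γ⁻¹ • y, i, hP, ?_⟩
      rw [gadgetPos, hγ, smul_inv_smul]
  rw [this]
  refine DMeas.exists fun i => DMeas.exists fun γ => DMeas.and (hX.dmeas_smul hP _) ?_
  exact DMeas.comp (f := fun y => sel (h i • γ⁻¹ • y))
    (hX.dmeas_smul (f := fun y => sel (h i • y)) (hX.dmeas_smul hselm _) _)
    fun g => g * h i = γ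

theorem dmeas_zone (hX : IsFreeBorel Γ X) (K : Finset Γ) {Y : X → Prop} (hY : DMeas Y) :
    DMeas (zone K Y) := by
  have : zone K Y = fun z => ∃ f : K, Y (f.1⁻¹ • z) := by
    funext z
    refine propext ⟨?_, ?_⟩
    · rintro ⟨f, hf, y, hy, rfl⟩
      exact ⟨⟨f, hf⟩, by rwa [inv_smul_smul]⟩
    · rintro ⟨f, hf⟩
      exact ⟨f.1, f.2, _, hf, (smul_inv_smul _ _).symm⟩
  rw [this]
  exact DMeas.exists fun f => hX.dmeas_smul hY _

/-- Prescribing the colors of an independent set changes a proper coloring only near it. -/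
theorem IsFreeBorel.exists_recolor [DecidableEq Γ] (hX : IsFreeBorel Γ X) {F : Finset Γ}
    (hFsym : ∀ σ ∈ F, σ⁻¹ ∈ F) (hF1 : (1 : Γ) ∉ F) {ℓ : ℕ} (hℓ : F.card + 1 ≤ ℓ)
    {c τ : X → Fin ℓ} (hc : DMeas c) (hcp : SchreierProper F c) (hτ : DMeas τ)
    {Y : X → Prop} (hY : DMeas Y) (hind : ∀ y, ∀ σ ∈ F, Y y → ¬ Y (σ • y)) :
    ∃ c' : X → Fin ℓ, DMeas c' ∧ SchreierProper F c' ∧ (∀ y, Y y → c' y = τ y) ∧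
      ∀ x, ¬ zone (insert 1 F) Y x → c' x = c x := by
  classical
  have hYz : ∀ y, Y y → zone (insert 1 F) Y y := fun y hy =>
    ⟨1, by simp, y, hy, (one_smul _ _).symm⟩
  have hFz : ∀ y, ∀ σ ∈ F, Y y → zone (insert 1 F) Y (σ • y) :=
    fun y σ hσ hy => ⟨σ, by simp [hσ], y, hy, rfl⟩
  obtain ⟨c', hc', hp, he⟩ := hX.exists_extend hFsym hF1 hℓ
    (U := fun x => zone (insert 1 F) Y x ∧ ¬ Y x) ((dmeas_zone hX _ hY).and hY.not)
    (c := fun x => if Y x then τ x else c x) (hY.ite hτ hc) (by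
      intro x σ hσ hx hσx
      by_cases h1 : Y x
      · exact absurd ⟨hFz x σ hσ h1, hind x σ hσ h1⟩ hσx
      · by_cases h2 : Y (σ • x)
        · refine absurd ⟨?_, h1⟩ hx
          simpa using hFz _ _ (hFsym σ hσ) h2
        · rw [if_neg h1, if_neg h2]
          exact hcp x σ hσ)
  refine ⟨c', hc', hp, fun y hy => ?_, fun x hx => ?_⟩
  · rw [he y (fun h => h.2 hy), if_pos hy]
  · rw [he x (fun h => hx h.1), if_neg (fun h => hx (hYz x h))]

/-- Recoloring around very sparse markers, so that each marker is distinguished from all its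
translates by `E`. -/
theorem IsGadget.exists_recolor_sparse [DecidableEq Γ] [Countable Γ] (hX : IsFreeBorel Γ X)
    {F : Finset Γ} (hFsym : ∀ σ ∈ F, σ⁻¹ ∈ F) (hF1 : (1 : Γ) ∉ F) {ℓ : ℕ} (hℓ : F.card + 1 ≤ ℓ)
    (hℓ2 : 2 ≤ ℓ)
    {t k : ℕ} {C B A E : Finset Γ} {h : Fin t × Fin (2 * k) → Γ} (hG : IsGadget F C B A h)
    (hE : E.card < 2 ^ t) (hE1 : 1 ∉ E) {sel : X → Γ} (hselm : DMeas sel)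
    (hsel : ∀ x, sel x ∈ C) {M : X → Prop}
    (hM : ∀ x, ∀ r ∈ interaction A B * interaction A B, M x → M (r • x) → r = 1)
    {P : X → Prop} (hP : DMeas P) (hPM : ∀ x, P x → M x)
    (hPE : ∀ m, ∀ u ∈ interaction A B, ∀ e ∈ E, P m → P (u • e • m) → u • e • m = m)
    {c : X → Fin ℓ} (hc : DMeas c) (hcp : SchreierProper F c) :
    ∃ c' : X → Fin ℓ, DMeas c' ∧ SchreierProper F c' ∧
      (∀ x, ¬ zone (insert 1 F) (gadgetPoints sel h P) x → c' x = c x) ∧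
      ∀ m, P m → ∀ e ∈ E, ∃ i, k ≤ (Finset.univ.filter fun s =>
        c' (gadgetPos sel h (i, s) m • m) ≠ c' (gadgetPos sel h (i, s) m • e • m)).card + 2 := by
  classical
  let col : Bool → Fin ℓ := fun b => if b then ⟨1, by omega⟩ else ⟨0, by omega⟩
  have hcol : col false ≠ col true := by simp [col]
  choose Φ hΦ using fun p : E → Fin t × Fin (2 * k) → Fin ℓ =>
    exists_block_bits (Finset.univ : Finset E) (by simpa using hE) col hcol p
  let bits : X → Fin t → Bool := fun m =>
    Φ fun e j => c (gadgetPos sel h j m • e.1 • m)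
  have hpos : ∀ j, DMeas fun m : X => gadgetPos sel h j m := fun j =>
    (hX.dmeas_smul hselm (h j)).comp fun g => g * h j
  have hbits : DMeas bits := by
    refine DMeas.comp (DMeas.pi fun e => DMeas.pi fun j => ?_) Φ
    exact DMeas.bind (f := fun g m => c (g • e.1 • m)) (hpos j) fun g =>
      hX.dmeas_smul (f := fun x => c (g • x)) (hX.dmeas_smul hc g) e.1
  let τ : X → Fin ℓ := fun y => if ∃ (j : Fin t × Fin (2 * k)) (γ : Γ),
    (P (γ⁻¹ • y) ∧ gadgetPos sel h j (γ⁻¹ • y) = γ) ∧ bits (γ⁻¹ • y) j.1 = true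
    then col true else col false
  have hτ : DMeas τ := by
    refine DMeas.ite (DMeas.exists fun j => DMeas.exists fun γ => DMeas.and (DMeas.and ?_ ?_) ?_)
      (DMeas.const _) (DMeas.const _)
    · exact hX.dmeas_smul hP _
    · exact (hX.dmeas_smul (hpos j) γ⁻¹).comp fun g => g = γ
    · exact (hX.dmeas_smul hbits γ⁻¹).comp fun b => b j.1 = true
  have hτe : ∀ m j, P m → τ (gadgetPos sel h j m • m) = col (bits m j.1) := by
    intro m j hm
    have : (∃ (j' : Fin t × Fin (2 * k)) (γ : Γ),
      (P (γ⁻¹ • gadgetPos sel h j m • m) ∧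
        gadgetPos sel h j' (γ⁻¹ • gadgetPos sel h j m • m) = γ) ∧
        bits (γ⁻¹ • gadgetPos sel h j m • m) j'.1 = true) ↔ bits m j.1 = true := by
      constructor
      · rintro ⟨j', γ, ⟨hP', hγ⟩, hb⟩
        obtain ⟨h1, rfl, -⟩ := hG.pos_inj hX hsel hM (hPM _ hm) (hPM _ hP') (i := j) (j := j')
          hG.one_mem (by rw [hγ, one_smul, smul_inv_smul])
        rwa [← h1] at hb
      · intro hb
        exact ⟨j, gadgetPos sel h j m, by simp [hm], by simpa using hb⟩
    by_cases hb : bits m j.1 = true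
    · simp only [τ, if_pos (this.2 hb), hb]
    · simp only [τ, if_neg (mt this.1 hb), Bool.eq_false_of_not_eq_true hb]
  have hYm := dmeas_gadgetPoints hX hselm h hP
  obtain ⟨c', hc', hp', hY, hoff⟩ := hX.exists_recolor hFsym hF1 hℓ hc hcp hτ hYm (by
    rintro y σ hσ ⟨m, i, hm, rfl⟩ ⟨m', i', hm', h2⟩
    obtain ⟨-, -, rfl⟩ := hG.pos_inj hX hsel hM (hPM _ hm') (hPM _ hm) (hG.subset hσ) h2.symm
    exact hF1 hσ)
  refine ⟨c', hc', hp', hoff, fun m hm e he => ?_⟩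
  obtain ⟨i, hi⟩ := hΦ (fun e j => c (gadgetPos sel h j m • e.1 • m)) ⟨e, he⟩ (Finset.mem_univ _)
  refine ⟨i, ?_⟩
  have hcol' : ∀ j, c' (gadgetPos sel h j m • m) = col (bits m j.1) := fun j => by
    rw [hY _ ⟨m, j, hm, rfl⟩, hτe m j hm]
  let S₁ := Finset.univ.filter fun s : Fin (2 * k) =>
    c (gadgetPos sel h (i, s) m • e • m) ≠ col (bits m i)
  let S₂ := Finset.univ.filter fun s : Fin (2 * k) =>
    c' (gadgetPos sel h (i, s) m • m) ≠ c' (gadgetPos sel h (i, s) m • e • m)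
  change k ≤ S₁.card at hi
  change k ≤ S₂.card + 2
  have hdiff : (S₁ \ S₂).card ≤ 2 := by
    have hinj : Function.Injective fun s : Fin (2 * k) => (i, s) := fun s s' hs => by
      simpa using hs
    rw [← Finset.card_map ⟨_, hinj⟩]
    refine hG.sidon e _ ?_
    intro j hj
    simp only [Finset.mem_map, Finset.mem_sdiff, Function.Embedding.coeFn_mk] at hj
    obtain ⟨s, ⟨hs1, hs2⟩, rfl⟩ := hj
    simp only [S₁, S₂, Finset.mem_filter, Finset.mem_univ, true_and, not_not] at hs1 hs2
    have hz : zone (insert 1 F) (gadgetPoints sel h P) (gadgetPos sel h (i, s) m • e • m) := by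
      by_contra hz
      rw [hcol', hoff _ hz] at hs2
      exact hs1 hs2.symm
    obtain ⟨f, hf, _, ⟨m', j, hm', rfl⟩, heq⟩ := hz
    have hfB := hG.range_mem hf
    have hm'e : m' = ((gadgetPos sel h j m')⁻¹ * f⁻¹ * gadgetPos sel h (i, s) m) • e • m := by
      rw [mul_smul, mul_smul, heq, inv_smul_smul, inv_smul_smul]
    have hmm : m' = m := by
      have := hPE m _ (mem_interaction (hG.pos_mem hsel j m') (hG.inv_mem f hfB)
        (hG.pos_mem hsel (i, s) m)) e he hm (hm'e ▸ hm')
      rw [hm'e, this]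
    subst hmm
    have hmul : gadgetPos sel h (i, s) m' * e = f * gadgetPos sel h j m' := by
      rw [← mul_smul, ← mul_smul] at heq
      exact hX.inj heq
    refine ⟨j, ?_, _, hsel _, _, hsel _, f, hfB, hmul⟩
    rintro rfl
    rcases Finset.mem_insert.1 hf with rfl | hfF
    · rw [one_mul, mul_eq_left] at hmul
      exact hE1 (hmul ▸ he)
    · exact hp' _ f hfF (hs2.trans (by rw [heq]))
  have h3 := Finset.card_le_card (Finset.subset_union_right (s₁ := S₂) (s₂ := S₁))
  rw [← Finset.union_sdiff_self_eq_union] at h3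
  have h4 := Finset.card_union_le S₂ (S₁ \ S₂)
  omega

end Recoloring

section Iteration

variable {Γ X : Type*} [Group Γ] [DecidableEq Γ] [MulAction Γ X] [MeasurableSpace X]

/-- Recoloring around the markers one class of `κ` at a time. A marker `m` stays distinguished from
`e • m` as long as no later marker interacts with `e • m`. -/
theorem IsGadget.exists_recolor_lt [Countable Γ] (hX : IsFreeBorel Γ X) {F : Finset Γ}
    (hFsym : ∀ σ ∈ F, σ⁻¹ ∈ F) (hF1 : (1 : Γ) ∉ F) {ℓ : ℕ} (hℓ : F.card + 1 ≤ ℓ) (hℓ2 : 2 ≤ ℓ)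
    {t k : ℕ} {C B A E : Finset Γ} {h : Fin t × Fin (2 * k) → Γ} (hG : IsGadget F C B A h)
    (hE : E.card < 2 ^ t) (hE1 : 1 ∉ E) {sel : X → Γ} (hselm : DMeas sel)
    (hsel : ∀ x, sel x ∈ C) {M : X → Prop} (hMm : DMeas M)
    (hM : ∀ x, ∀ r ∈ interaction A B * interaction A B, M x → M (r • x) → r = 1)
    {κ : X → ℕ} (hκm : DMeas κ)
    (hκ : ∀ m, ∀ u ∈ interaction A B, ∀ e ∈ E, κ (u • e • m) = κ m → u • e • m = m)
    {c : X → Fin ℓ} (hc : DMeas c) (hcp : SchreierProper F c) (j : ℕ) :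
    ∃ c' : X → Fin ℓ, DMeas c' ∧ SchreierProper F c' ∧
      (∀ x, ¬ zone (insert 1 F) (gadgetPoints sel h fun m => M m ∧ κ m < j) x → c' x = c x) ∧
      ∀ m, M m → κ m < j → ∀ e ∈ E,
        (∀ u ∈ interaction A B, M (u • e • m) → κ (u • e • m) ≤ κ m) →
        ∃ i, k ≤ (Finset.univ.filter fun s =>
          c' (gadgetPos sel h (i, s) m • m) ≠ c' (gadgetPos sel h (i, s) m • e • m)).card + 2 := by
  induction j with
  | zero => exact ⟨c, hc, hcp, fun _ _ => rfl, fun m _ h => absurd h (by omega)⟩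
  | succ j ih =>
    obtain ⟨c₁, hc₁, hp₁, hoff₁, hd₁⟩ := ih
    obtain ⟨c₂, hc₂, hp₂, hoff₂, hd₂⟩ := hG.exists_recolor_sparse hX hFsym hF1 hℓ hℓ2 hE hE1 hselm
      hsel hM (P := fun m => M m ∧ κ m = j) (hMm.and (hκm.comp fun n => n = j)) (fun _ h => h.1)
      (fun m u hu e he h1 h2 => hκ m u hu e he (h2.2.trans h1.2.symm)) hc₁ hp₁
    refine ⟨c₂, hc₂, hp₂, fun x hx => ?_, fun m hm hmj e he hlate => ?_⟩
    · rw [hoff₂, hoff₁]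
      · refine fun h => hx (h.mono ?_)
        rintro y ⟨m, i, hm, rfl⟩
        exact ⟨m, i, ⟨hm.1, by omega⟩, rfl⟩
      · refine fun h => hx (h.mono ?_)
        rintro y ⟨m, i, hm, rfl⟩
        exact ⟨m, i, ⟨hm.1, by omega⟩, rfl⟩
    · by_cases hmj' : κ m = j
      · exact hd₂ m ⟨hm, hmj'⟩ e he
      obtain ⟨i, hi⟩ := hd₁ m hm (by omega) e he hlate
      refine ⟨i, ?_⟩
      have h1 : ∀ s, c₂ (gadgetPos sel h s m • m) = c₁ (gadgetPos sel h s m • m) := by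
        refine fun s => hoff₂ _ ?_
        rintro ⟨f, hf, _, ⟨m', s', hm', rfl⟩, heq⟩
        obtain ⟨rfl, -⟩ := hG.pos_inj hX hsel hM hm hm'.1 (hG.range_mem hf) heq
        exact hmj' hm'.2
      have h2 : ∀ s, c₂ (gadgetPos sel h s m • e • m) = c₁ (gadgetPos sel h s m • e • m) := by
        refine fun s => hoff₂ _ ?_
        rintro ⟨f, hf, _, ⟨m', s', hm', rfl⟩, heq⟩
        have hm'e : m' = ((gadgetPos sel h s' m')⁻¹ * f⁻¹ * gadgetPos sel h s m) • e • m := by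
          rw [mul_smul, mul_smul, heq, inv_smul_smul, inv_smul_smul]
        have := hlate _ (mem_interaction (hG.pos_mem hsel s' m')
          (hG.inv_mem f (hG.range_mem hf)) (hG.pos_mem hsel s m)) (hm'e ▸ hm'.1)
        rw [← hm'e, hm'.2] at this
        omega
      simpa only [h1, h2] using hi

end Iteration

section Stage

theorem exists_isGadget {Γ : Type*} [Group Γ] [DecidableEq Γ] [Infinite Γ] {F C L : Finset Γ}
    (hC : C.Nonempty) (hL1 : 1 ∈ L) (hLF : F ⊆ L) (k : ℕ) (hk : 0 < k) :
    ∃ (t : ℕ) (B A : Finset Γ) (h : Fin t × Fin (2 * k) → Γ), IsGadget F C B A h ∧ L ⊆ B ∧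
      A.Nonempty ∧ 2 * (interaction A B).card ^ 3 < 2 ^ t := by
  let B : Finset Γ := L ∪ L⁻¹
  obtain ⟨t, ht0, ht⟩ := exists_pow_lt_two_pow (2 * (C.card * (2 * k)) ^ 6 * B.card ^ 3) 6
  obtain ⟨h, hsp, hsi⟩ := exists_generic_family (Γ := Γ) (Fin t × Fin (2 * k)) (C⁻¹ * B * C)
  let A : Finset Γ := C * Finset.univ.image h
  refine ⟨t, B, A, h, ⟨Finset.mem_union_left _ hL1, ?_, ?_, ?_, ?_, ?_⟩,
    Finset.subset_union_left, ?_, ?_⟩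
  · intro b hb
    rcases Finset.mem_union.1 hb with hb | hb
    · exact Finset.mem_union_right _ (Finset.inv_mem_inv hb)
    · exact Finset.mem_union_left _ (Finset.mem_inv'.1 hb)
  · exact hLF.trans Finset.subset_union_left
  · exact fun i c hc => Finset.mul_mem_mul hc (Finset.mem_image_of_mem _ (Finset.mem_univ _))
  · intro i j hij c hc c' hc' b hb heq
    refine hsp i j hij (c'⁻¹ * b * c)
      (Finset.mul_mem_mul (Finset.mul_mem_mul (Finset.inv_mem_inv hc') hb) hc) ?_
    rw [mul_assoc, mul_assoc, ← heq, inv_mul_cancel_left]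
  · intro e S hS
    refine hsi e S fun i hi => ?_
    obtain ⟨j, hj, c, hc, c', hc', b, hb, heq⟩ := hS i hi
    refine ⟨j, hj, c⁻¹ * b * c',
      Finset.mul_mem_mul (Finset.mul_mem_mul (Finset.inv_mem_inv hc) hb) hc', ?_⟩
    rw [mul_assoc, mul_assoc, ← heq, mul_assoc, inv_mul_cancel_left]
  · exact hC.mul ⟨h (⟨0, ht0⟩, ⟨0, by omega⟩), by simp⟩
  · have hA : A.card ≤ C.card * (t * (2 * k)) :=
      Finset.card_mul_le.trans (Nat.mul_le_mul_left _ (Finset.card_image_le.trans (by simp)))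
    have hJ : (interaction A B).card ≤ A.card * B.card * A.card :=
      Finset.card_mul_le.trans (Nat.mul_le_mul_right _
        (Finset.card_mul_le.trans (by rw [Finset.card_inv])))
    calc 2 * (interaction A B).card ^ 3
        ≤ 2 * (C.card * (t * (2 * k)) * B.card * (C.card * (t * (2 * k)))) ^ 3 := by
          gcongr
          exact hJ.trans (by gcongr)
      _ = 2 * (C.card * (2 * k)) ^ 6 * B.card ^ 3 * t ^ 6 := by ring
      _ < 2 ^ t := ht

variable {Γ X : Type*} [Group Γ] [DecidableEq Γ] [MulAction Γ X] [MeasurableSpace X]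

/-- The conjugates of `γ` and `γ⁻¹` by elements of `R`. -/
def conjugates (R : Finset Γ) (γ : Γ) : Finset Γ :=
  R.image (fun v => v * γ * v⁻¹) ∪ R.image fun v => v * γ⁻¹ * v⁻¹

theorem card_conjugates_le (R : Finset Γ) (γ : Γ) : (conjugates R γ).card ≤ 2 * R.card := by
  have h1 := Finset.card_image_le (s := R) (f := fun v => v * γ * v⁻¹)
  have h2 := Finset.card_image_le (s := R) (f := fun v => v * γ⁻¹ * v⁻¹)
  have h3 := Finset.card_union_le (R.image fun v => v * γ * v⁻¹) (R.image fun v => v * γ⁻¹ * v⁻¹)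
  unfold conjugates
  omega

theorem one_notMem_conjugates (R : Finset Γ) {γ : Γ} (hγ : γ ≠ 1) : 1 ∉ conjugates R γ := by
  simp [conjugates, hγ]

/-- Recoloring around a maximal sparse set of markers distinguishes every point `x` from `γ • x`
within a bounded window. -/
theorem IsGadget.exists_recolor_separating [Countable Γ] (hX : IsFreeBorel Γ X) {F : Finset Γ}
    (hFsym : ∀ σ ∈ F, σ⁻¹ ∈ F) (hF1 : (1 : Γ) ∉ F) {ℓ : ℕ} (hℓ : F.card + 1 ≤ ℓ) (hℓ2 : 2 ≤ ℓ)
    {t k : ℕ} {C B A : Finset Γ} {h : Fin t × Fin (2 * k) → Γ} (hG : IsGadget F C B A h)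
    (hA : A.Nonempty) (hcard : 2 * (interaction A B).card ^ 3 < 2 ^ t) {γ : Γ} (hγ : γ ≠ 1)
    {sel : X → Γ} (hselm : DMeas sel) (hsel : ∀ x, sel x ∈ C) {M : X → Prop} (hMm : DMeas M)
    (hM : ∀ x, ∀ r ∈ interaction A B * interaction A B, M x → M (r • x) → r = 1)
    (hMmax : ∀ x, ∃ r ∈ interaction A B * interaction A B, M (r • x))
    {c : X → Fin ℓ} (hc : DMeas c) (hcp : SchreierProper F c) :
    ∃ c' : X → Fin ℓ, DMeas c' ∧ SchreierProper F c' ∧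
      (∀ x, ¬ zone (insert 1 F) (gadgetPoints sel h M) x → c' x = c x) ∧
      ∀ x, ∃ v ∈ interaction A B * (interaction A B * interaction A B), ∃ T ⊆ A,
        k ≤ T.card + 2 ∧ ∀ a ∈ T, c' (a • v • x) ≠ c' (a • v • γ • x) := by
  set J := interaction A B with hJ
  have h1J : 1 ∈ J := one_mem_interaction hG.one_mem hA
  let E := conjugates (J * (J * J)) γ
  have hE : E.card < 2 ^ t := by
    refine ((card_conjugates_le _ γ).trans (Nat.mul_le_mul_left 2 ?_)).trans_lt hcard
    calc (J * (J * J)).card ≤ J.card * (J.card * J.card) :=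
          Finset.card_mul_le.trans (Nat.mul_le_mul_left _ Finset.card_mul_le)
      _ = J.card ^ 3 := by ring
  have hE1 : 1 ∉ E := one_notMem_conjugates _ hγ
  obtain ⟨Q, κ, hκm, hκQ, hκ⟩ := hX.exists_coloring (J * E)
  obtain ⟨c', hc', hp', hoff, hd⟩ := hG.exists_recolor_lt hX hFsym hF1 hℓ hℓ2 hE hE1 hselm hsel hMm
    hM hκm (fun m u hu e he hum => by
      by_contra hne
      rw [← mul_smul] at hum hne
      exact hκ _ (Finset.mul_mem_mul hu he) (fun h => hne (by rw [h, one_smul])) _ hum) hc hcp Q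
  refine ⟨c', hc', hp', fun x hx => hoff x fun h => hx (h.mono ?_), ?_⟩
  · rintro y ⟨m, i, hm, rfl⟩
    exact ⟨m, i, hm.1, rfl⟩
  have key : ∀ m, M m → ∀ e ∈ E, (∀ u ∈ J, M (u • e • m) → κ (u • e • m) ≤ κ m) →
      ∃ T ⊆ A, k ≤ T.card + 2 ∧ ∀ a ∈ T, c' (a • m) ≠ c' (a • e • m) := by
    intro m hm e he hlate
    obtain ⟨i, hi⟩ := hd m hm (hκQ m) e he hlate
    refine ⟨(Finset.univ.filter fun s => c' (gadgetPos sel h (i, s) m • m) ≠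
      c' (gadgetPos sel h (i, s) m • e • m)).image fun s => gadgetPos sel h (i, s) m, ?_, ?_, ?_⟩
    · simp only [Finset.subset_iff, Finset.mem_image]
      rintro _ ⟨s, -, rfl⟩
      exact hG.pos_mem hsel _ _
    · rwa [Finset.card_image_of_injective]
      intro s s' hs
      obtain ⟨-, h2, -⟩ := hG.pos_inj hX hsel hM hm hm (i := (i, s)) (j := (i, s')) hG.one_mem
        (by rw [one_smul]; exact congrArg (· • m) hs)
      simpa using h2
    · simp only [Finset.mem_image, Finset.mem_filter]
      rintro _ ⟨s, hs, rfl⟩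
      exact hs.2
  intro x
  obtain ⟨η, hη, hm⟩ := hMmax x
  have hη3 : η ∈ J * (J * J) := by simpa using Finset.mul_mem_mul h1J hη
  by_cases hlate : ∀ u ∈ J, M (u • (η * γ * η⁻¹) • η • x) →
      κ (u • (η * γ * η⁻¹) • η • x) ≤ κ (η • x)
  · obtain ⟨T, hTA, hTc, hT⟩ := key _ hm _
      (Finset.mem_union_left _ (Finset.mem_image_of_mem _ hη3)) hlate
    refine ⟨η, hη3, T, hTA, hTc, fun a ha => ?_⟩
    have := hT a ha
    rwa [mul_smul, mul_smul, inv_smul_smul] at this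
  · push Not at hlate
    obtain ⟨u, hu, hm', hκ'⟩ := hlate
    rw [mul_smul, mul_smul, inv_smul_smul] at hm' hκ'
    have hv : u * η ∈ J * (J * J) := Finset.mul_mem_mul hu hη
    have he' : ((u * η) * γ⁻¹ * (u * η)⁻¹) • u • η • γ • x = u • η • x := by
      simp only [← mul_smul]
      congr 1
      group
    obtain ⟨T, hTA, hTc, hT⟩ := key _ hm' _
      (Finset.mem_union_right _ (Finset.mem_image_of_mem _ hv)) (by
        intro u' hu' hm''
        rw [he'] at hm'' ⊢
        rw [← mul_smul] at hm'' ⊢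
        have := hM _ _ (Finset.mul_mem_mul hu' hu) hm hm''
        rw [this, one_smul]
        exact hκ'.le)
    refine ⟨u * η, hv, T, hTA, hTc, fun a ha => ?_⟩
    have := hT a ha
    rw [he'] at this
    rw [mul_smul u η x, mul_smul u η (γ • x)]
    exact this.symm

end Stage

section Stage

/-- The outcome `c'` of one stage of recoloring of `c`: it differs from `c` only near the sparse
set `Y`, which avoids `W`, and it separates `x` from `γ • x` robustly within a bounded window. -/
structure IsStage {Γ X : Type*} [Group Γ] [DecidableEq Γ] [MulAction Γ X] [MeasurableSpace X]
    (F V C A R : Finset Γ) (γ : Γ) {ℓ : ℕ} (c : X → Fin ℓ) (W : X → Prop) (c' : X → Fin ℓ)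
    (Y : X → Prop) : Prop where
  dmeas_color : DMeas c'
  proper : SchreierProper F c'
  dmeas_points : DMeas Y
  eq_off : ∀ x, ¬ zone (insert 1 F) Y x → c' x = c x
  avoids : ∀ y, Y y → ¬ W y
  discrete : ∀ y, ∀ v ∈ V, Y y → Y (v • y) → v = 1
  codense : ∀ x, ∃ s ∈ C, ¬ (W (s • x) ∨ zone V Y (s • x))
  separates : ∀ x, ∃ v ∈ R, ∃ T ⊆ A, 2 * (insert 1 F).card + 1 ≤ T.card ∧
    ∀ a ∈ T, c' (a • v • x) ≠ c' (a • v • γ • x)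

variable {Γ : Type*} [Group Γ]

theorem exists_measurable_selector {X : Type*} [MulAction Γ X] [MeasurableSpace X] [Countable Γ]
    (hX : IsFreeBorel Γ X) {W : X → Prop} (hW : DMeas W) {C : Finset Γ}
    (hC : ∀ x, ∃ s ∈ C, ¬ W (s • x)) :
    ∃ sel : X → Γ, DMeas sel ∧ (∀ x, sel x ∈ C) ∧ ∀ x, ¬ W (sel x • x) := by
  classical
  let pick : (C → Prop) → Γ := fun p => if hp : ∃ s, ¬ p s then (Classical.choose hp).1 else 1
  have hpick : ∀ x, ∃ h : ∃ s : C, ¬ W (s.1 • x),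
      pick (fun s => W (s.1 • x)) = (Classical.choose h).1 := fun x => by
    obtain ⟨s, hs, hsW⟩ := hC x
    have h : ∃ s : C, ¬ W (s.1 • x) := ⟨⟨s, hs⟩, hsW⟩
    exact ⟨h, dif_pos h⟩
  refine ⟨fun x => pick fun s => W (s.1 • x),
    DMeas.comp (DMeas.pi fun s => hX.dmeas_smul hW s.1) pick, fun x => ?_, fun x => ?_⟩
  · obtain ⟨h, h'⟩ := hpick x
    simp only [h']
    exact (Classical.choose h).2
  · obtain ⟨h, h'⟩ := hpick x
    simp only [h']
    exact Classical.choose_spec h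

/-- One stage of recoloring is always possible, with bounds that do not depend on the action. -/
theorem exists_isStage [DecidableEq Γ] [Countable Γ] [Infinite Γ] {F : Finset Γ}
    (hFsym : ∀ σ ∈ F, σ⁻¹ ∈ F) (hF1 : (1 : Γ) ∉ F) {ℓ : ℕ} (hℓ : F.card + 1 ≤ ℓ) (hℓ2 : 2 ≤ ℓ)
    {γ : Γ} (hγ : γ ≠ 1) {C : Finset Γ} (hC : C.Nonempty) (V : Finset Γ) :
    ∃ C' A R : Finset Γ, C'.Nonempty ∧
      ∀ (X : Type) [MulAction Γ X] [MeasurableSpace X], IsFreeBorel Γ X →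
        ∀ (c : X → Fin ℓ) (W : X → Prop), DMeas c → SchreierProper F c → DMeas W →
          (∀ x, ∃ s ∈ C, ¬ W (s • x)) →
          ∃ (c' : X → Fin ℓ) (Y : X → Prop), IsStage F V C' A R γ c W c' Y := by
  obtain ⟨g, hg⟩ := Infinite.exists_notMem_finset (C⁻¹ * V * V⁻¹ * C)
  let L : Finset Γ := insert 1 (F ∪ V ∪ V⁻¹ * C * {g} * C⁻¹ * V)
  obtain ⟨t, B, A, h, hG, hLB, hA, hcard⟩ := exists_isGadget (F := F) (L := L) hC
    (Finset.mem_insert_self _ _)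
    (fun x hx => Finset.mem_insert_of_mem (Finset.mem_union_left _ (Finset.mem_union_left _ hx)))
    (2 * (insert 1 F).card + 1 + 2) (by omega)
  refine ⟨C ∪ C * {g}, A, interaction A B * (interaction A B * interaction A B),
    hC.mono Finset.subset_union_left, ?_⟩
  intro X _ _ hX c W hc hcp hW hCW
  obtain ⟨sel, hselm, hsel, hselW⟩ := exists_measurable_selector hX hW hCW
  have hJinv := fun u => inv_mem_interaction hG.inv_mem (A := A) (u := u)
  have h1J : 1 ∈ interaction A B := one_mem_interaction hG.one_mem hA
  obtain ⟨M, hMm, hM, hMmax⟩ := hX.exists_maximal (interaction A B * interaction A B)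
    (fun r hr => by
      obtain ⟨u, hu, u', hu', rfl⟩ := Finset.mem_mul.1 hr
      rw [mul_inv_rev]
      exact Finset.mul_mem_mul (hJinv _ hu') (hJinv _ hu))
    (by simpa using Finset.mul_mem_mul h1J h1J)
  obtain ⟨c', hc', hp', hoff, hsep⟩ := hG.exists_recolor_separating hX hFsym hF1 hℓ hℓ2 hA hcard hγ
    hselm hsel hMm hM hMmax hc hcp
  refine ⟨c', gadgetPoints sel h M, hc', hp', dmeas_gadgetPoints hX hselm h hMm, hoff, ?_, ?_, ?_,
    fun x => ?_⟩
  · rintro _ ⟨m, i, -, rfl⟩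
    rw [gadgetPos, mul_smul]
    exact hselW _
  · rintro _ v hv ⟨m, i, hm, rfl⟩ ⟨m', i', hm', heq⟩
    exact (hG.pos_inj hX hsel hM hm' hm (hLB (by simp [L, hv])) heq.symm).2.2
  · intro x
    obtain ⟨s, hs, hsW⟩ := hCW x
    by_cases hsz : zone V (gadgetPoints sel h M) (s • x)
    · obtain ⟨s', hs', hsW'⟩ := hCW (g • x)
      refine ⟨s' * g, Finset.mem_union_right _
        (Finset.mul_mem_mul hs' (Finset.mem_singleton_self g)), ?_⟩
      rw [mul_smul]
      rintro (h' | ⟨v', hv', _, ⟨m', i', hm', rfl⟩, h2⟩)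
      · exact hsW' h'
      obtain ⟨v, hv, _, ⟨m, i, hm, rfl⟩, h1⟩ := hsz
      refine hg ?_
      have hb : v'⁻¹ * s' * g * s⁻¹ * v ∈ B := by
        refine hLB (Finset.mem_insert_of_mem (Finset.mem_union_right _ ?_))
        exact Finset.mul_mem_mul (Finset.mul_mem_mul (Finset.mul_mem_mul (Finset.mul_mem_mul
          (Finset.inv_mem_inv hv') hs') (Finset.mem_singleton_self g)) (Finset.inv_mem_inv hs)) hv
      obtain ⟨-, -, h3⟩ := hG.pos_inj hX hsel hM hm' hm hb (by
        rw [mul_smul, ← h1, mul_smul, inv_smul_smul, mul_smul, mul_smul, h2, inv_smul_smul])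
      have : g = s'⁻¹ * v' * v⁻¹ * s := by
        rw [mul_eq_one_iff_eq_inv, mul_inv_eq_iff_eq_mul, mul_assoc,
          inv_mul_eq_iff_eq_mul, ← eq_inv_mul_iff_mul_eq] at h3
        simpa only [mul_assoc] using h3
      rw [this]
      exact Finset.mul_mem_mul (Finset.mul_mem_mul (Finset.mul_mem_mul (Finset.inv_mem_inv hs')
        hv') (Finset.inv_mem_inv hv)) hs
    · exact ⟨s, Finset.mem_union_left _ hs, not_or.2 ⟨hsW, hsz⟩⟩
  · obtain ⟨v, hv, T, hTA, hTc, hT⟩ := hsep x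
    exact ⟨v, hv, T, hTA, by omega, hT⟩

end Stage

section Limit

variable {Γ : Type*} [Group Γ] [DecidableEq Γ]

/-- Bounds for an infinite sequence of stages, the `n`-th one separating points from their
`g n`-translates. The spacing `V j` takes into account the windows of all earlier stages. -/
theorem exists_stage_bounds [Countable Γ] [Infinite Γ] {F : Finset Γ}
    (hFsym : ∀ σ ∈ F, σ⁻¹ ∈ F) (hF1 : (1 : Γ) ∉ F) {ℓ : ℕ} (hℓ : F.card + 1 ≤ ℓ) (hℓ2 : 2 ≤ ℓ)
    {g : ℕ → Γ} (hg : ∀ n, g n ≠ 1) :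
    ∃ C V A R : ℕ → Finset Γ, C 0 = {1} ∧
      (∀ n j, n < j → ∀ f ∈ insert 1 F, ∀ b ∈ insert 1 (A n * (A n)⁻¹), ∀ f' ∈ insert 1 F,
        f⁻¹ * b * f' ∈ V j) ∧
      ∀ n, ∀ (X : Type) [MulAction Γ X] [MeasurableSpace X], IsFreeBorel Γ X →
        ∀ (c : X → Fin ℓ) (W : X → Prop), DMeas c → SchreierProper F c → DMeas W →
          (∀ x, ∃ s ∈ C n, ¬ W (s • x)) →
          ∃ (c' : X → Fin ℓ) (Y : X → Prop),
            IsStage F (V n) (C (n + 1)) (A n) (R n) (g n) c W c' Y := by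
  choose C' A R hne hstage using fun (n : ℕ) (p : {C : Finset Γ // C.Nonempty} × Finset Γ) =>
    exists_isStage hFsym hF1 hℓ hℓ2 (hg n) p.1.2 p.2
  let U : ℕ → {C : Finset Γ // C.Nonempty} × Finset Γ → Finset Γ := fun n p =>
    (insert 1 F)⁻¹ * insert 1 (A n p * (A n p)⁻¹) * insert 1 F
  let st : ℕ → {C : Finset Γ // C.Nonempty} × Finset Γ := fun n =>
    Nat.rec (⟨{1}, Finset.singleton_nonempty 1⟩, ∅)
      (fun n p => (⟨C' n p, hne n p⟩, p.2 ∪ U n p)) n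
  refine ⟨fun n => (st n).1, fun n => (st n).2, fun n => A n (st n), fun n => R n (st n), rfl, ?_,
    fun n => hstage n (st n)⟩
  intro n j hnj f hf b hb f' hf'
  have hmem : f⁻¹ * b * f' ∈ U n (st n) :=
    Finset.mul_mem_mul (Finset.mul_mem_mul (Finset.inv_mem_inv hf) hb) hf'
  induction j, hnj using Nat.le_induction with
  | base => exact Finset.mem_union_right _ hmem
  | succ j _ ih => exact Finset.mem_union_left _ ih

variable {X : Type} [MulAction Γ X] [MeasurableSpace X]

/-- A sequence of stages of recoloring; `W n` collects the neighborhoods of the points recolored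
before stage `n`. -/
structure IsStageSeq (F : Finset Γ) (g : ℕ → Γ) (C V A R : ℕ → Finset Γ) {ℓ : ℕ}
    (c : ℕ → X → Fin ℓ) (W Y : ℕ → X → Prop) : Prop where
  window : ∀ n j, n < j → ∀ f ∈ insert 1 F, ∀ b ∈ insert 1 (A n * (A n)⁻¹), ∀ f' ∈ insert 1 F,
    f⁻¹ * b * f' ∈ V j
  color : ∀ n, DMeas (c n) ∧ SchreierProper F (c n)
  stage : ∀ n, IsStage F (V n) (C (n + 1)) (A n) (R n) (g n) (c n) (W n) (c (n + 1)) (Y n)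
  reserved : ∀ n, W (n + 1) = fun x => W n x ∨ zone (V n) (Y n) x

theorem exists_isStageSeq [Countable Γ] (hX : IsFreeBorel Γ X) {F : Finset Γ}
    (hFsym : ∀ σ ∈ F, σ⁻¹ ∈ F) (hF1 : (1 : Γ) ∉ F) {ℓ : ℕ} (hℓ : F.card + 1 ≤ ℓ)
    {g : ℕ → Γ} {C V A R : ℕ → Finset Γ} (hC0 : C 0 = {1})
    (hwin : ∀ n j, n < j → ∀ f ∈ insert 1 F, ∀ b ∈ insert 1 (A n * (A n)⁻¹), ∀ f' ∈ insert 1 F,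
      f⁻¹ * b * f' ∈ V j)
    (hstage : ∀ n, ∀ (c : X → Fin ℓ) (W : X → Prop), DMeas c → SchreierProper F c → DMeas W →
      (∀ x, ∃ s ∈ C n, ¬ W (s • x)) → ∃ (c' : X → Fin ℓ) (Y : X → Prop),
        IsStage F (V n) (C (n + 1)) (A n) (R n) (g n) c W c' Y) :
    ∃ (c : ℕ → X → Fin ℓ) (W Y : ℕ → X → Prop), IsStageSeq F g C V A R c W Y := by
  obtain ⟨c₀, hc₀, hp₀, -⟩ := hX.exists_extend hFsym hF1 hℓ (U := fun _ => True) (DMeas.const _)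
    (c := fun _ => ⟨0, by omega⟩) (DMeas.const _) (fun _ _ _ h => absurd trivial h)
  let S : ℕ → Type := fun n => {p : (X → Fin ℓ) × (X → Prop) //
    (DMeas p.1 ∧ SchreierProper F p.1) ∧ DMeas p.2 ∧ ∀ x, ∃ s ∈ C n, ¬ p.2 (s • x)}
  have hstep : ∀ n (p : S n), ∃ (q : S (n + 1)) (Y : X → Prop),
      IsStage F (V n) (C (n + 1)) (A n) (R n) (g n) p.1.1 p.1.2 q.1.1 Y ∧
        q.1.2 = fun x => p.1.2 x ∨ zone (V n) Y x := by
    rintro n ⟨⟨c, W⟩, ⟨hc, hp⟩, hW, hd⟩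
    obtain ⟨c', Y, h⟩ := hstage n c W hc hp hW hd
    exact ⟨⟨⟨c', fun x => W x ∨ zone (V n) Y x⟩, ⟨h.dmeas_color, h.proper⟩,
      hW.or (dmeas_zone hX _ h.dmeas_points), h.codense⟩, Y, h, rfl⟩
  choose next Y hY hW using hstep
  let st : ∀ n, S n := fun n => Nat.rec
    ⟨⟨c₀, fun _ => False⟩, ⟨hc₀, hp₀⟩, DMeas.const _, fun _ => ⟨1, by simp [hC0], not_false⟩⟩ next n
  exact ⟨fun n => (st n).1.1, fun n => (st n).1.2, fun n => Y n (st n), hwin,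
    fun n => (st n).2.1, fun n => hY n (st n), fun n => hW n (st n)⟩

namespace IsStageSeq

variable {F : Finset Γ} {g : ℕ → Γ} {C V A R : ℕ → Finset Γ} {ℓ : ℕ}
  {c : ℕ → X → Fin ℓ} {W Y : ℕ → X → Prop}

theorem reserved_mono (hS : IsStageSeq F g C V A R c W Y) {j k : ℕ} (hjk : j ≤ k) {x : X}
    (hx : W j x) : W k x := by
  induction k, hjk using Nat.le_induction with
  | base => exact hx
  | succ k _ ih => rw [hS.reserved]; exact Or.inl ih

theorem eq_of_smul_eq (hS : IsStageSeq F g C V A R c W Y) {n j k : ℕ} (hnj : n < j) (hjk : j ≤ k)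
    {y y' : X} (hy : Y j y) (hy' : Y k y') {f f' b : Γ} (hf : f ∈ insert 1 F)
    (hf' : f' ∈ insert 1 F) (hb : b ∈ insert 1 (A n * (A n)⁻¹)) (heq : b • f • y = f' • y') :
    j = k ∧ y = y' := by
  have hV := hS.window n j hnj f' hf' b hb f hf
  have hyy : y' = (f'⁻¹ * b * f) • y := by
    rw [mul_smul, mul_smul, heq, inv_smul_smul]
  rcases hjk.eq_or_lt with rfl | hjk
  · have := (hS.stage j).discrete y _ hV hy (hyy ▸ hy')
    exact ⟨rfl, by rw [hyy, this, one_smul]⟩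
  · refine absurd ?_ ((hS.stage k).avoids y' hy')
    refine hS.reserved_mono (j := j + 1) hjk ?_
    rw [hS.reserved]
    exact Or.inr ⟨_, hV, y, hy, hyy⟩

theorem eq_of_unchanged (hS : IsStageSeq F g C V A R c W Y) {n : ℕ} {x : X}
    (hx : ∀ k, n < k → ¬ zone (insert 1 F) (Y k) x) {k : ℕ} (hk : n + 1 ≤ k) :
    c k x = c (n + 1) x := by
  induction k, hk using Nat.le_induction with
  | base => rfl
  | succ k hk ih => rw [(hS.stage k).eq_off x (hx k hk), ih]

theorem eventually_const (hS : IsStageSeq F g C V A R c W Y) (x : X) :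
    ∃ K, ∀ k, K ≤ k → c k x = c K x := by
  by_cases h : ∃ j, 0 < j ∧ zone (insert 1 F) (Y j) x
  · obtain ⟨j, hj, f, hf, y, hy, rfl⟩ := h
    refine ⟨j + 1, fun k hk => hS.eq_of_unchanged ?_ hk⟩
    rintro k hjk ⟨f', hf', y', hy', heq⟩
    have := (hS.eq_of_smul_eq hj hjk.le hy hy' hf hf' (Finset.mem_insert_self _ _)
      (by rwa [one_smul])).1
    omega
  · push Not at h
    exact ⟨1, fun k hk => hS.eq_of_unchanged (n := 0) h hk⟩

theorem card_changed_le (hS : IsStageSeq F g C V A R c W Y) (hX : IsFreeBorel Γ X) {n : ℕ}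
    (z : X) {T : Finset Γ} (hT : T ⊆ A n)
    (hTc : ∀ a ∈ T, ∃ k, n < k ∧ zone (insert 1 F) (Y k) (a • z)) :
    T.card ≤ (insert 1 F).card := by
  rcases T.eq_empty_or_nonempty with rfl | ⟨a₀, ha₀⟩
  · simp
  obtain ⟨k₀, hk₀, f₀, hf₀, y₀, hy₀, heq₀⟩ := hTc a₀ ha₀
  have hex : ∀ a ∈ T, ∃ f ∈ insert 1 F, a • z = f • y₀ := by
    intro a ha
    obtain ⟨k, hk, f, hf, y, hy, heq⟩ := hTc a ha
    have hmem : ∀ a ∈ T, ∀ a' ∈ T, a * a'⁻¹ ∈ insert 1 (A n * (A n)⁻¹) := fun a ha a' ha' =>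
      Finset.mem_insert_of_mem (Finset.mul_mem_mul (hT ha) (Finset.inv_mem_inv (hT ha')))
    suffices y = y₀ from ⟨f, hf, this ▸ heq⟩
    rcases le_total k k₀ with hkk | hkk
    · refine (hS.eq_of_smul_eq hk hkk hy hy₀ hf hf₀ (hmem a₀ ha₀ a ha) ?_).2
      rw [← heq, ← heq₀, mul_smul, inv_smul_smul]
    · refine (hS.eq_of_smul_eq hk₀ hkk hy₀ hy hf₀ hf (hmem a ha a₀ ha₀) ?_).2.symm
      rw [← heq, ← heq₀, mul_smul, inv_smul_smul]
  choose! φ hφ hφe using hex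
  refine Finset.card_le_card_of_injOn φ hφ fun a ha a' ha' h => ?_
  refine hX.inj (x := z) ?_
  rw [hφe a ha, hφe a' ha', h]

theorem exists_limit (hS : IsStageSeq F g C V A R c W Y) (hX : IsFreeBorel Γ X) :
    ∃ d : X → Fin ℓ, DMeas d ∧ SchreierProper F d ∧
      ∀ n x, ∃ v ∈ R n, ∃ a ∈ A n, d (a • v • x) ≠ d (a • v • g n • x) := by
  classical
  choose K hK using hS.eventually_const
  have hlim : ∀ x k, K x ≤ k → c (K x) x = c k x := fun x k hk => (hK x k hk).symm
  refine ⟨fun x => c (K x) x, DMeas.of_fiber fun i => ?_, fun x σ hσ => ?_, fun n x => ?_⟩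
  · have : {x | c (K x) x = i} = ⋃ N, ⋂ k, {x | c (N + k) x = i} := by
      ext x
      simp only [Set.mem_iUnion, Set.mem_iInter, Set.mem_ofPred_eq]
      constructor
      · exact fun h => ⟨K x, fun k => by rw [hK x _ (by omega), h]⟩
      · rintro ⟨N, h⟩
        rw [hlim x (N + K x) (by omega), h]
    rw [this]
    exact MeasurableSet.iUnion fun N => MeasurableSet.iInter fun k => (hS.color _).1.fiber i
  · simp only [hlim x (K x + K (σ • x)) (by omega), hlim (σ • x) (K x + K (σ • x)) (by omega)]
    exact (hS.color _).2 x σ hσ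
  · obtain ⟨v, hv, T, hTA, hTc, hT⟩ := (hS.stage n).separates x
    let T' : X → Finset Γ := fun z =>
      T.filter fun a => ∃ k, n < k ∧ zone (insert 1 F) (Y k) (a • z)
    have hT' : ∀ z, (T' z).card ≤ (insert 1 F).card := fun z =>
      hS.card_changed_le hX z ((Finset.filter_subset _ _).trans hTA)
        fun a ha => (Finset.mem_filter.1 ha).2
    have hlt : (T' (v • x) ∪ T' (v • g n • x)).card < T.card := by
      have := Finset.card_union_le (T' (v • x)) (T' (v • g n • x))
      have := hT' (v • x)
      have := hT' (v • g n • x)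
      omega
    obtain ⟨a, ha, ha'⟩ := Finset.exists_mem_notMem_of_card_lt_card hlt
    have hconst : ∀ z, a ∉ T' z → c (K (a • z)) (a • z) = c (n + 1) (a • z) := by
      intro z hz
      rw [hlim _ (n + 1 + K (a • z)) (by omega)]
      refine hS.eq_of_unchanged (fun k hk hzone => hz ?_) (by omega)
      exact Finset.mem_filter.2 ⟨ha, k, hk, hzone⟩
    rw [Finset.mem_union, not_or] at ha'
    refine ⟨v, hv, a, hTA ha, ?_⟩
    simp only [hconst _ ha'.1, hconst _ ha'.2]
    exact hT a ha

end IsStageSeq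

end Limit

section SeparatedColorings

/-- The proper colorings separating each `γ` from `γ * g n` within a bounded window. -/
def separatedCol {Γ : Type} [Group Γ] (F : Finset Γ) (ℓ : ℕ) (g : ℕ → Γ) (A R : ℕ → Finset Γ) :
    Set (Γ → Fin ℓ) :=
  {y | y ∈ properCol F ℓ ∧ ∀ n, ∀ ε : Γ, ∃ v ∈ R n, ∃ a ∈ A n,
    y (a * (v * ε)) ≠ y (a * (v * (g n * ε)))}

variable {Γ : Type} [Group Γ] {F : Finset Γ} {ℓ : ℕ} {g : ℕ → Γ} {A R : ℕ → Finset Γ}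

theorem isSubshift_separatedCol : IsSubshift (separatedCol F ℓ g A R) := by
  have hcl : ∀ p q : Γ, IsClosed {y : Γ → Fin ℓ | y p ≠ y q} := fun p q =>
    IsClosed.preimage (f := fun y : Γ → Fin ℓ => (y p, y q))
      ((continuous_apply p).prodMk (continuous_apply q))
      (isClosed_discrete {z : Fin ℓ × Fin ℓ | z.1 ≠ z.2})
  refine ⟨?_, fun γ y hy => ⟨fun δ σ hσ => ?_, fun n ε => ?_⟩⟩
  · have : separatedCol F ℓ g A R =
        (⋂ γ, ⋂ σ ∈ F, {y : Γ → Fin ℓ | y γ ≠ y (σ * γ)}) ∩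
        ⋂ n, ⋂ ε, ⋃ v ∈ R n, ⋃ a ∈ A n,
          {y : Γ → Fin ℓ | y (a * (v * ε)) ≠ y (a * (v * (g n * ε)))} := by
      ext y
      simp [separatedCol, properCol]
    rw [this]
    refine (isClosed_iInter fun γ => isClosed_biInter fun σ _ => hcl _ _).inter
      (isClosed_iInter fun n => isClosed_iInter fun ε => ?_)
    exact isClosed_biUnion_finset fun v _ => isClosed_biUnion_finset fun a _ => hcl _ _
  · simpa [shiftAct, mul_assoc] using hy.1 (δ * γ) σ hσ
  · simpa [shiftAct, mul_assoc] using hy.2 n (ε * γ)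

theorem separatedCol_subset_freePart (hg : ∀ γ, γ ≠ 1 → ∃ n, g n = γ) :
    separatedCol F ℓ g A R ⊆ freePart Γ (Fin ℓ) := by
  intro y hy γ hγ
  by_contra hne
  obtain ⟨n, rfl⟩ := hg γ hne
  obtain ⟨v, -, a, -, h⟩ := hy.2 n 1
  refine h ?_
  have := congrFun hγ (a * v)
  simpa [shiftAct, mul_assoc] using this.symm

end SeparatedColorings

/-- Corollary `coloring`.  If `F ⊂ Γ` is a nonempty finite symmetric
set with `1 ∉ F` and `ℓ ≥ |F| + 1`, then there is a free subshift `S ⊆ Col(F, ℓ)`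
such that every free Borel action of `Γ` on a Polish space admits a Borel
`Γ`-equivariant map to `S`. -/
theorem stmt1 {Γ : Type} [Group Γ] [Countable Γ] [Infinite Γ]
    (F : Finset Γ) (hFne : F.Nonempty) (hFsym : ∀ σ ∈ F, σ⁻¹ ∈ F) (hF1 : (1 : Γ) ∉ F)
    (ℓ : ℕ) (hℓ : F.card + 1 ≤ ℓ) :
    ∃ S : Set (Γ → Fin ℓ), S ⊆ properCol F ℓ ∧ IsSubshift S ∧
      S ⊆ freePart Γ (Fin ℓ) ∧
      (∀ (X : Type) [TopologicalSpace X] [PolishSpace X] [MeasurableSpace X] [BorelSpace X]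
        (a : Γ → X → X),
        (∀ x, a 1 x = x) →
        (∀ γ δ : Γ, ∀ x, a (γ * δ) x = a γ (a δ x)) →
        (∀ γ : Γ, Measurable (a γ)) →
        (∀ (γ : Γ) (x : X), a γ x = x → γ = 1) →
        ∃ f : X → (Γ → Fin ℓ), Measurable f ∧ (∀ x, f x ∈ S) ∧
          ∀ (γ : Γ) (x : X), f (a γ x) = shiftAct γ (f x)) := by
  classical
  have hℓ2 : 2 ≤ ℓ := by have := hFne.card_pos; omega
  obtain ⟨γ₀, hγ₀⟩ := exists_ne (1 : Γ)
  have : Nonempty {γ : Γ // γ ≠ 1} := ⟨⟨γ₀, hγ₀⟩⟩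
  obtain ⟨g, hg⟩ := exists_surjective_nat {γ : Γ // γ ≠ 1}
  obtain ⟨C, V, A, R, hC0, hwin, hstage⟩ :=
    exists_stage_bounds hFsym hF1 hℓ hℓ2 (g := fun n => (g n).1) fun n => (g n).2
  refine ⟨separatedCol F ℓ (fun n => (g n).1) A R, fun y hy => hy.1, isSubshift_separatedCol,
    separatedCol_subset_freePart fun γ hγ => (hg ⟨γ, hγ⟩).imp fun n hn => congrArg Subtype.val hn,
    ?_⟩
  intro X _ _ _ _ a ha1 hamul hameas hafree
  let _ : MulAction Γ X := { smul := a, one_smul := ha1, mul_smul := hamul }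
  have hX : IsFreeBorel Γ X := isFreeBorel_of_polish hameas hafree
  obtain ⟨c, W, Y, hS⟩ := exists_isStageSeq hX hFsym hF1 hℓ hC0 hwin fun n c W => hstage n X hX c W
  obtain ⟨d, hd, hdp, hds⟩ := hS.exists_limit hX
  refine ⟨fun x δ => d (δ • x), ?_, fun x => ⟨fun γ σ hσ => ?_, fun n ε => ?_⟩, fun γ x => ?_⟩
  · exact measurable_pi_lambda _ fun δ => fun s _ => hX.dmeas_smul hd δ s
  · change d (γ • x) ≠ d ((σ * γ) • x)
    rw [mul_smul]
    exact hdp _ σ hσ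
  · simpa only [mul_smul] using hds n (ε • x)
  · funext δ
    exact congrArg d (mul_smul δ γ x).symm
end

section
/- Let Γ be a countably infinite group, let S be a subshift of finite type (inside m^Γ for some m ≥ 1), and let π : Free(k^Γ) → S be a continuous Γ-equivariant map for some k ≥ 2. Then there exist a finite symmetric set F ⊂ Γ with 1 ∉ F, an integer ℓ ≥ |F| + 1, and a continuous Γ-equivariant map π̃ : Col(F, ℓ) → S such that Stab(π̃) = Stab(π). -/
open scoped Pointwise
section LocallyConstant

variable {Γ : Type} [Group Γ] {Y : Type} [MulAction Γ Y] [TopologicalSpace Y]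
  [ContinuousConstSMul Γ Y] {C : Type*}

theorem IsLocallyConstant.eventually_smul_eq {f : Y → C} (hf : IsLocallyConstant f)
    (R : Finset Γ) (y : Y) : ∀ᶠ z in nhds y, ∀ w ∈ R, f (w • z) = f (w • y) :=
  (Filter.eventually_all_finset R).2 fun w _ =>
    (hf.comp_continuous (continuous_const_smul w)).eventually_eq y

theorem IsLocallyConstant.eventually_inv_smul_eq {f : Y → C} (hf : IsLocallyConstant f)
    (R : Finset Γ) (y : Y) : ∀ᶠ z in nhds y, ∀ w ∈ R, f (w⁻¹ • z) = f (w⁻¹ • y) :=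
  (Filter.eventually_all_finset R).2 fun w _ =>
    (hf.comp_continuous (continuous_const_smul w⁻¹)).eventually_eq y

end LocallyConstant

section Greedy

variable {Γ : Type} [Group Γ] {Y : Type} [MulAction Γ Y] {C : Type*}

/-- Greedy recursion along a rank function `κ`: the value at `y` is computed from the values at
those `σ • y`, `σ ∈ A`, which have smaller rank. -/
theorem exists_greedy (κ : Y → ℕ) (A : Finset Γ) (G : Y → (A → Option C) → C) :
    ∃ c : Y → C, ∀ y, c y = G y fun σ =>
      if κ ((σ : Γ) • y) < κ y then some (c ((σ : Γ) • y)) else none := by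
  classical
  let H : (y : Y) → ((z : Y) → κ z < κ y → C) → C := fun y rec =>
    G y fun σ => if h : κ ((σ : Γ) • y) < κ y then some (rec _ h) else none
  refine ⟨(measure κ).wf.fix H, fun y => ?_⟩
  rw [WellFounded.fix_eq]
  simp only [H, dite_eq_ite]

theorem isLocallyConstant_of_greedy [TopologicalSpace Y] [ContinuousConstSMul Γ Y] {κ : Y → ℕ}
    (hκ : IsLocallyConstant κ) {A : Finset Γ} {G : Y → (A → Option C) → C}
    (hG : ∀ t, IsLocallyConstant fun y => G y t) {c : Y → C}
    (hc : ∀ y, c y = G y fun σ =>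
      if κ ((σ : Γ) • y) < κ y then some (c ((σ : Γ) • y)) else none) :
    IsLocallyConstant c := by
  rw [IsLocallyConstant.iff_eventually_eq]
  intro y
  induction hn : κ y using Nat.strong_induction_on generalizing y with
  | _ n ih =>
    have h2 : ∀ᶠ z in nhds y, ∀ σ ∈ A, κ (σ • y) < κ y → c (σ • z) = c (σ • y) := by
      refine (Filter.eventually_all_finset A).2 fun σ _ => ?_
      by_cases h : κ (σ • y) < κ y
      · filter_upwards [(continuous_const_smul σ).continuousAt.eventually
          (ih _ (hn ▸ h) (σ • y) rfl)] with z hz _ using hz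
      · exact Filter.Eventually.of_forall fun z h' => absurd h' h
    filter_upwards [h2, hκ.eventually_smul_eq A y, hκ.eventually_eq y,
      (hG (fun σ => if κ ((σ : Γ) • y) < κ y then some (c ((σ : Γ) • y)) else none)).eventually_eq y]
      with z h2 h3 h4 h5
    rw [hc z, hc y, ← h5]
    congr 1
    funext σ
    rw [h3 σ σ.2, h4]
    split_ifs with h
    · rw [h2 σ σ.2 h]
    · rfl

/-- A proper colouring can be reduced to one with `|A| + 1` colours. -/
theorem exists_coloring (κ : Y → ℕ) (A : Finset Γ) (hA : ∀ σ ∈ A, σ⁻¹ ∈ A)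
    (hκ : ∀ y, ∀ σ ∈ A, κ (σ • y) ≠ κ y) :
    ∃ c : Y → ℕ, (∀ y, c y ≤ A.card) ∧ (∀ y, ∀ σ ∈ A, c (σ • y) ≠ c y) ∧
      ∀ [TopologicalSpace Y] [ContinuousConstSMul Γ Y], IsLocallyConstant κ →
        IsLocallyConstant c := by
  classical
  have hex : ∀ t : A → Option ℕ, ∃ n, n ≤ A.card ∧ ∀ σ, t σ ≠ some n := by
    intro t
    have hcard : (Finset.univ.image fun σ => (t σ).getD 0).card <
        (Finset.range (A.card + 1)).card :=
      lt_of_le_of_lt Finset.card_image_le (by simp)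
    obtain ⟨n, hn, hn'⟩ := Finset.exists_mem_notMem_of_card_lt_card hcard
    refine ⟨n, Nat.lt_succ_iff.1 (Finset.mem_range.1 hn), fun σ h => hn' ?_⟩
    exact Finset.mem_image.2 ⟨σ, Finset.mem_univ _, by simp [h]⟩
  choose g hg1 hg2 using hex
  obtain ⟨c, hc⟩ := exists_greedy κ A fun _ => g
  have key : ∀ y, ∀ σ ∈ A, κ (σ • y) < κ y → c (σ • y) ≠ c y := by
    intro y σ hσ hlt h
    have := hg2 (fun σ => if κ ((σ : Γ) • y) < κ y then some (c ((σ : Γ) • y)) else none) ⟨σ, hσ⟩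
    rw [← hc y] at this
    simp [hlt, h] at this
  refine ⟨c, fun y => (hc y) ▸ hg1 _, fun y σ hσ => ?_, fun hκc =>
    isLocallyConstant_of_greedy hκc (fun t => IsLocallyConstant.const _) hc⟩
  rcases lt_or_gt_of_ne (hκ y σ hσ) with h | h
  · exact key y σ hσ h
  · have := key (σ • y) σ⁻¹ (hA σ hσ) (by simpa using h)
    simpa using this.symm

/-- Maximal separated subsets. -/
theorem exists_maximal_separated [TopologicalSpace Y] [ContinuousConstSMul Γ Y] {κ : Y → ℕ}
    (hκc : IsLocallyConstant κ) (A : Finset Γ) (hA : ∀ σ ∈ A, σ⁻¹ ∈ A)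
    (hκ : ∀ y, ∀ σ ∈ A, κ (σ • y) ≠ κ y) {M : Y → Prop} (hM : IsLocallyConstant M) :
    ∃ N : Y → Prop, IsLocallyConstant N ∧ (∀ y, N y → M y) ∧
      (∀ y, ∀ σ ∈ A, N y → ¬ N (σ • y)) ∧ ∀ y, M y → N y ∨ ∃ σ ∈ A, N (σ • y) := by
  classical
  obtain ⟨N, hN⟩ := exists_greedy κ A
    fun y (t : A → Option Prop) => M y ∧ ∀ σ p, t σ = some p → ¬ p
  have hN' : ∀ y, N y ↔ M y ∧ ∀ σ ∈ A, κ (σ • y) < κ y → ¬ N (σ • y) := by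
    intro y
    rw [hN y]
    refine and_congr_right fun _ => ⟨fun h σ hσ hlt => ?_, fun h σ p hp => ?_⟩
    · exact h ⟨σ, hσ⟩ _ (by simp [hlt])
    · beta_reduce at hp
      split_ifs at hp with hlt
      rw [← Option.some.inj hp]
      exact h σ σ.2 hlt
  refine ⟨N, isLocallyConstant_of_greedy
    (G := fun y (t : A → Option Prop) => M y ∧ ∀ σ p, t σ = some p → ¬ p) hκc (fun t => ?_) hN,
    fun y h => ((hN' y).1 h).1, fun y σ hσ h1 h2 => ?_, fun y hy => ?_⟩
  · exact hM.comp fun p => p ∧ ∀ σ q, t σ = some q → ¬ q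
  · rcases lt_or_gt_of_ne (hκ y σ hσ) with h | h
    · exact ((hN' y).1 h1).2 σ hσ h h2
    · exact ((hN' _).1 h2).2 σ⁻¹ (hA σ hσ) (by simpa using h) (by simpa using h1)
  · by_contra! hcon
    exact hcon.1 ((hN' y).2 ⟨hy, fun σ hσ _ => hcon.2 σ hσ⟩)

end Greedy

section Levels

variable {Γ : Type} [Group Γ]

/-- A set of markers `q` together with a set of data points `d`. -/
@[ext]
structure MarkerState (Y : Type) where
  q : Y → Prop
  d : Y → Prop

/-- Parameters of one coding level. -/
structure LevelData (Γ : Type) where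
  r : ℕ
  R : ℕ → Finset Γ
  W : Finset Γ
  F : Finset Γ

/-- The pullback of a marker state. -/
def MarkerState.comap {Y Z : Type} (S : MarkerState Y) (h : Z → Y) : MarkerState Z :=
  ⟨fun z => S.q (h z), fun z => S.d (h z)⟩

/-- The bit stored in the region `R • y`. -/
def readBit {Y : Type} [MulAction Γ Y] (R : Finset Γ) (d : Y → Prop) (y : Y) : Prop :=
  ∃ w ∈ R, d (w • y)

/-- Decoding of the next marker state. -/
def MarkerState.next {Y : Type} [MulAction Γ Y] (R : ℕ → Finset Γ) (S : MarkerState Y) :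
    MarkerState Y :=
  ⟨fun y => S.q y ∧ readBit (R 0) S.d y, fun y => S.q y ∧ readBit (R 1) S.d y⟩

/-- The markers are syndetic, and the labels distinguish the markers `w • y` and `w • γ • y`. -/
def IsLevel {Y : Type} [MulAction Γ Y] (γ : Γ) (p : LevelData Γ) (S : MarkerState Y) : Prop :=
  (∀ y, ∃ w ∈ p.W, S.q (w • y)) ∧
    ∀ y, ∀ w ∈ p.W, S.q (w • y) → S.q (w • γ • y) →
      ∃ j < p.r, ¬ (readBit (p.R (j + 2)) S.d (w • y) ↔ readBit (p.R (j + 2)) S.d (w • γ • y))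

/-- Validity of `n` consecutive levels, starting from level `i`. -/
def IsTower {Y : Type} [MulAction Γ Y] (g : ℕ → Γ) (p : ℕ → LevelData Γ) :
    ℕ → ℕ → MarkerState Y → Prop
  | 0, _, _ => True
  | n + 1, i, S => IsLevel (g i) (p i) S ∧ IsTower g p n (i + 1) (S.next (p i).R)

section Comap

variable {Y Z : Type} [MulAction Γ Y] [MulAction Γ Z] {h : Z → Y}

theorem readBit_comp (hh : ∀ (γ : Γ) z, h (γ • z) = γ • h z) (R : Finset Γ) (d : Y → Prop)
    (z : Z) : readBit R (fun z => d (h z)) z ↔ readBit R d (h z) := by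
  simp [readBit, hh]

theorem MarkerState.next_comap (hh : ∀ (γ : Γ) z, h (γ • z) = γ • h z) (R : ℕ → Finset Γ)
    (S : MarkerState Y) : (S.comap h).next R = (S.next R).comap h := by
  simp [MarkerState.next, MarkerState.comap, readBit_comp hh]

theorem IsTower.comap (hh : ∀ (γ : Γ) z, h (γ • z) = γ • h z) {g : ℕ → Γ} {p : ℕ → LevelData Γ} :
    ∀ {n i : ℕ} {S : MarkerState Y}, IsTower g p n i S → IsTower g p n i (S.comap h)
  | 0, _, _, _ => trivial
  | n + 1, i, S, ⟨⟨h1, h2⟩, h3⟩ => by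
    refine ⟨⟨fun z => ?_, fun z w hw hq hq' => ?_⟩, ?_⟩
    · simpa [MarkerState.comap, hh] using h1 (h z)
    · simp only [MarkerState.comap, hh, readBit_comp hh] at hq hq' ⊢
      exact h2 (h z) w hw hq hq'
    · rw [MarkerState.next_comap hh]
      exact IsTower.comap hh h3

end Comap

theorem IsTower.of_succ {Y : Type} [MulAction Γ Y] {g : ℕ → Γ} {p : ℕ → LevelData Γ} :
    ∀ {n i : ℕ} {S : MarkerState Y}, IsTower g p (n + 1) i S → IsTower g p n i S
  | 0, _, _, _ => trivial
  | _ + 1, _, _, ⟨h1, h2⟩ => ⟨h1, IsTower.of_succ h2⟩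

theorem IsTower.not_period {g : ℕ → Γ} {p : ℕ → LevelData Γ} {γ : Γ} (n j i : ℕ)
    (S : MarkerState Γ) (hS : S.comap (· * γ) = S) (hj : g (i + j) = γ)
    (h : IsTower g p (n + j + 1) i S) : False := by
  have hh : ∀ (δ : Γ) (z : Γ), (δ • z) * γ = δ • (z * γ) := fun δ z => by simp [mul_assoc]
  induction j generalizing i S with
  | zero =>
    obtain ⟨⟨h1, h2⟩, -⟩ := h
    obtain ⟨w, hw, hq⟩ := h1 1
    have hbit : ∀ z, readBit ((p i).R z) S.d (w • g i • (1 : Γ)) ↔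
        readBit ((p i).R z) S.d (w • (1 : Γ)) := by
      intro z
      have := readBit_comp (h := (· * γ)) hh ((p i).R z) S.d (w • (1 : Γ))
      rw [show (fun z => S.d (z * γ)) = S.d from congrArg MarkerState.d hS] at this
      rw [this, ← hj]
      simp
    have hq' : S.q (w • g i • (1 : Γ)) := by
      have : S.q (w • (1 : Γ) * γ) = S.q (w • (1 : Γ)) :=
        congrFun (congrArg MarkerState.q hS) (w • (1 : Γ))
      rw [← this, ← hj] at hq
      simpa using hq
    obtain ⟨j, -, hne⟩ := h2 1 w hw hq hq'
    exact hne (hbit _).symm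
  | succ j ih =>
    refine ih (i + 1) (S.next (p i).R) ?_ (by rw [← hj]; congr 1; ring) h.2
    rw [← MarkerState.next_comap hh, hS]

section Closed

variable {X : Type} [TopologicalSpace X]

theorem isLocallyConstant_readBit {Y : Type} [MulAction Γ Y] (R : Finset Γ) {d : X → Y → Prop}
    (hd : ∀ y, IsLocallyConstant fun x => d x y) (y : Y) :
    IsLocallyConstant fun x => readBit R (d x) y := by
  rw [IsLocallyConstant.iff_eventually_eq]
  intro x
  filter_upwards [(Filter.eventually_all_finset R).2 fun w _ => (hd (w • y)).eventually_eq x]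
    with z hz
  exact propext (exists_congr fun w => and_congr_right fun hw => by rw [hz w hw])

theorem isClosed_isTower {Y : Type} [MulAction Γ Y] {g : ℕ → Γ} {p : ℕ → LevelData Γ} (n i : ℕ)
    (S : X → MarkerState Y) (hq : ∀ y, IsLocallyConstant fun x => (S x).q y)
    (hd : ∀ y, IsLocallyConstant fun x => (S x).d y) :
    IsClosed {x | IsTower g p n i (S x)} := by
  induction n generalizing i S with
  | zero => simp [IsTower]
  | succ n ih =>
    have h1 : IsClosed {x | ∀ y, ∃ w ∈ (p i).W, (S x).q (w • y)} := by
      rw [show {x | ∀ y, ∃ w ∈ (p i).W, (S x).q (w • y)} =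
        ⋂ y, {x | readBit (p i).W (S x).q y = True} by ext; simp [readBit]]
      exact isClosed_iInter fun y => (isLocallyConstant_readBit _ hq y).isClosed_fiber _
    let D (y : Y) (w : Γ) (x : X) : Prop := (S x).q (w • y) → (S x).q (w • g i • y) →
      ∃ j < (p i).r, ¬ (readBit ((p i).R (j + 2)) (S x).d (w • y) ↔
        readBit ((p i).R (j + 2)) (S x).d (w • g i • y))
    have key : ∀ y w, IsLocallyConstant (D y w) := by
      intro y w
      rw [IsLocallyConstant.iff_eventually_eq]
      intro x
      filter_upwards [(hq (w • y)).eventually_eq x, (hq (w • g i • y)).eventually_eq x,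
        (Filter.eventually_all_finset (Finset.range (p i).r)).2 fun j _ =>
          (isLocallyConstant_readBit ((p i).R (j + 2)) hd (w • y)).eventually_eq x,
        (Filter.eventually_all_finset (Finset.range (p i).r)).2 fun j _ =>
          (isLocallyConstant_readBit ((p i).R (j + 2)) hd (w • g i • y)).eventually_eq x]
        with z h1 h2 h3 h4
      simp only [D, h1, h2]
      refine propext (imp_congr_right fun _ => imp_congr_right fun _ => exists_congr fun j =>
        and_congr_right fun hj => ?_)
      rw [h3 j (Finset.mem_range.2 hj), h4 j (Finset.mem_range.2 hj)]
    have h2 : IsClosed {x | ∀ y, ∀ w ∈ (p i).W, D y w x} := by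
      rw [show {x | ∀ y, ∀ w ∈ (p i).W, D y w x} =
        ⋂ y, ⋂ w ∈ (p i).W, {x | D y w x = True} by ext; simp]
      exact isClosed_iInter fun y => isClosed_biInter fun w hw => (key y w).isClosed_fiber _
    exact (h1.inter h2).inter <| ih (i + 1) _
      (fun y => (hq y).comp₂ (isLocallyConstant_readBit _ hd y) And)
      (fun y => (hq y).comp₂ (isLocallyConstant_readBit _ hd y) And)

end Closed

end Levels

section Coding

variable {Γ : Type} [Group Γ]

theorem exists_disjoint_translates [Infinite Γ] (W : Finset Γ) :
    ∃ g : ℕ → Γ, ∀ i j, i ≠ j → ∀ w ∈ W, ∀ w' ∈ W, w * g i ≠ w' * g j := by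
  classical
  let r : Γ → Γ → Prop := fun a b => ∀ w ∈ W, ∀ w' ∈ W, w * a ≠ w' * b
  have : Std.Symm r := ⟨fun a b h w hw w' hw' e => h w' hw' w hw e.symm⟩
  obtain ⟨g, -, hg⟩ := exists_seq_of_forall_finset_exists' (fun _ => True) r fun s _ => by
    obtain ⟨y, hy⟩ := Infinite.exists_notMem_finset (W⁻¹ * W * s)
    refine ⟨y, trivial, fun x hx w hw w' hw' e => hy ?_⟩
    rw [show y = w'⁻¹ * w * x by rw [mul_assoc, e, inv_mul_cancel_left]]
    exact Finset.mul_mem_mul (Finset.mul_mem_mul (Finset.inv_mem_inv hw') hw) hx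
  exact ⟨g, fun i j hij => hg hij⟩

theorem exists_two_pow_gt (w : ℕ) : ∃ r, 2 * ((((r + 2) * w) ^ 2 + 1) * w) < 2 ^ r := by
  refine ⟨(w + 4) * 8, ?_⟩
  rw [pow_mul]
  have h1 : w + 4 < 2 ^ (w + 4) := Nat.lt_two_pow_self
  have h2 : 16 ≤ 2 ^ (w + 4) := by
    rw [pow_add]; linarith [Nat.one_le_two_pow (n := w)]
  generalize 2 ^ (w + 4) = x at h1 h2
  have h3 : ((w + 4) * 8 + 2) * w ≤ 9 * x * x := Nat.mul_le_mul (by linarith) (by linarith)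
  calc 2 * (((((w + 4) * 8 + 2) * w) ^ 2 + 1) * w) ≤ 2 * (((9 * x * x) ^ 2 + x ^ 4) * x) := by
        gcongr
        · exact Nat.one_le_pow _ _ (by linarith)
        · linarith
    _ = 164 * x ^ 5 := by ring
    _ < 16 ^ 3 * x ^ 5 := by gcongr; norm_num
    _ ≤ x ^ 3 * x ^ 5 := by gcongr
    _ = x ^ 8 := by ring

/-- On every `W`-syndetic set `M` one can carry out one step of the coding, in a locally constant
way: choose markers `M'` with labels `c`, so that arbitrary bits `b j` can be written around the
points of `M'`. -/
def LevelData.Codes (p : LevelData Γ) (γ : Γ) (W : Finset Γ) : Prop :=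
  (1 : Γ) ∉ p.F ∧ ∀ (Y : Type) [MulAction Γ Y] [TopologicalSpace Y] [ContinuousConstSMul Γ Y]
    (κ : Y → ℕ), IsLocallyConstant κ → (∀ y, ∀ σ ∈ p.F, κ (σ • y) ≠ κ y) →
    ∀ M : Y → Prop, IsLocallyConstant M → (∀ y, ∃ w ∈ W, M (w • y)) →
    ∃ (M' : Y → Prop) (c : ℕ → Y → Prop), IsLocallyConstant M' ∧
      (∀ j, IsLocallyConstant (c j)) ∧ (∀ y, M' y → M y) ∧ (∀ y, ∃ w ∈ p.W, M' (w • y)) ∧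
      (∀ y, ∀ w ∈ p.W, M' (w • y) → M' (w • γ • y) →
        ∃ j < p.r, ¬ (c j (w • y) ↔ c j (w • γ • y))) ∧
      ∀ b : ℕ → Y → Prop, (∀ j, IsLocallyConstant (b j)) →
        ∃ d : Y → Prop, IsLocallyConstant d ∧ (∀ y, d y → M y) ∧
          ∀ y, M' y → ∀ j < p.r + 2, (readBit (p.R j) d y ↔ b j y)

theorem exists_levelData [Infinite Γ] {γ : Γ} (hγ : γ ≠ 1) (W : Finset Γ) :
    ∃ p : LevelData Γ, p.Codes γ W := by
  classical
  obtain ⟨g, hg⟩ := exists_disjoint_translates W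
  obtain ⟨r, hr⟩ := exists_two_pow_gt W.card
  let R : ℕ → Finset Γ := fun j => W * {g j}
  have hRW : ∀ {j u}, u ∈ R j ↔ ∃ w ∈ W, w * g j = u := by
    intro j u
    simp [R, Finset.mem_mul]
  have hR : ∀ {i j u}, u ∈ R i → u ∈ R j → i = j := by
    intro i j u hi hj
    obtain ⟨w, hw, rfl⟩ := hRW.1 hi
    obtain ⟨w', hw', e⟩ := hRW.1 hj
    by_contra hij
    exact hg i j hij w hw w' hw' e.symm
  let U : Finset Γ := (Finset.range (r + 2)).biUnion R
  let F1 : Finset Γ := (U⁻¹ * U).erase 1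
  have hF1 : ∀ σ ∈ F1, σ⁻¹ ∈ F1 := by
    intro σ hσ
    obtain ⟨h1, h2⟩ := Finset.mem_erase.1 hσ
    refine Finset.mem_erase.2 ⟨inv_ne_one.2 h1, ?_⟩
    have := Finset.inv_mem_inv h2
    rwa [mul_inv_rev, inv_inv] at this
  let W' : Finset Γ := insert 1 F1 * W
  let A : Finset Γ := W'.image fun w => w * γ * w⁻¹
  let B : Finset Γ := A ∪ A⁻¹
  have hB : ∀ σ ∈ B, σ⁻¹ ∈ B := by
    intro σ hσ
    rcases Finset.mem_union.1 hσ with h | h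
    · exact Finset.mem_union_right _ (Finset.inv_mem_inv h)
    · exact Finset.mem_union_left _ (Finset.mem_inv'.1 h)
  have hA1 : (1 : Γ) ∉ A := by
    intro h
    obtain ⟨w, -, hw⟩ := Finset.mem_image.1 h
    exact hγ (conj_eq_one_iff.1 hw)
  have hB1 : (1 : Γ) ∉ B := by
    intro h
    rcases Finset.mem_union.1 h with h | h
    · exact hA1 h
    · exact hA1 (by simpa using h)
  have hcard : B.card < 2 ^ r := by
    refine lt_of_le_of_lt ?_ hr
    have hU : U.card ≤ (r + 2) * W.card := by
      refine (Finset.card_biUnion_le_card_mul _ _ W.card fun j _ => ?_).trans (by simp)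
      simp [R]
    have hF : F1.card ≤ ((r + 2) * W.card) ^ 2 := by
      refine (Finset.card_erase_le.trans Finset.card_mul_le).trans ?_
      rw [Finset.card_inv, sq]
      exact Nat.mul_le_mul hU hU
    have hW : W'.card ≤ (((r + 2) * W.card) ^ 2 + 1) * W.card :=
      Finset.card_mul_le.trans
        (Nat.mul_le_mul_right _ ((Finset.card_insert_le _ _).trans (by linarith)))
    have hA : A.card ≤ (((r + 2) * W.card) ^ 2 + 1) * W.card := Finset.card_image_le.trans hW
    refine (Finset.card_union_le _ _).trans ?_
    rw [Finset.card_inv]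
    linarith
  refine ⟨⟨r, R, W', F1 ∪ B⟩, ?_, ?_⟩
  · simp only [Finset.mem_union, not_or]
    exact ⟨Finset.notMem_erase _ _, hB1⟩
  intro Y _ _ _ κ hκc hκ M hM hMW
  obtain ⟨M', hM'c, hM'M, hsep, hmax⟩ := exists_maximal_separated hκc F1 hF1
    (fun y σ hσ => hκ y σ (Finset.mem_union_left _ hσ)) hM
  obtain ⟨c, hcle, hc, hcc⟩ := exists_coloring κ B hB
    (fun y σ hσ => hκ y σ (Finset.mem_union_right _ hσ))
  refine ⟨M', fun j y => (c y).testBit j, hM'c, fun j => (hcc hκc).comp fun n => n.testBit j = true,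
    hM'M, fun y => ?_, fun y w hw _ _ => ?_, fun b hb => ?_⟩
  · obtain ⟨w, hw, hMw⟩ := hMW y
    rcases hmax _ hMw with h | ⟨σ, hσ, h⟩
    · exact ⟨w, by simpa using Finset.mul_mem_mul (Finset.mem_insert_self 1 F1) hw, h⟩
    · exact ⟨σ * w, Finset.mul_mem_mul (Finset.mem_insert_of_mem hσ) hw, by rwa [mul_smul]⟩
  · have hne : c (w • γ • y) ≠ c (w • y) := by
      rw [show w • γ • y = (w * γ * w⁻¹) • w • y by simp [smul_smul]]
      exact hc _ _ (Finset.mem_union_left _ (Finset.mem_image_of_mem _ hw))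
    by_contra! hcon
    refine hne (Nat.eq_of_testBit_eq fun j => ?_)
    rcases lt_or_ge j r with hj | hj
    · exact (Bool.eq_iff_iff.2 (hcon j hj)).symm
    · have hlt : ∀ z, (c z).testBit j = false := fun z => Nat.testBit_lt_two_pow
        ((hcle z).trans_lt (hcard.trans_le (Nat.pow_le_pow_right two_pos hj)))
      rw [hlt, hlt]
  · refine ⟨fun z => ∃ j < r + 2, ∃ u ∈ R j, M z ∧ M' (u⁻¹ • z) ∧ b j (u⁻¹ • z), ?_,
      fun y ⟨j, hj, u, hu, h, _⟩ => h, fun y hy j hj => ⟨?_, fun h => ?_⟩⟩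
    · rw [IsLocallyConstant.iff_eventually_eq]
      intro y
      filter_upwards [hM.eventually_eq y, hM'c.eventually_inv_smul_eq U y,
        (Filter.eventually_all_finset (Finset.range (r + 2))).2 fun j _ =>
          (hb j).eventually_inv_smul_eq U y] with z h1 h2 h3
      rw [h1]
      refine propext (exists_congr fun j => and_congr_right fun hj => exists_congr fun u =>
        and_congr_right fun hu => ?_)
      have hu' : u ∈ U := Finset.mem_biUnion.2 ⟨j, Finset.mem_range.2 hj, hu⟩
      rw [h2 u hu', h3 j (Finset.mem_range.2 hj) u hu']
    · rintro ⟨w, hw, j', hj', u, hu, -, hM', hb'⟩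
      have hwu : u⁻¹ * w = 1 := by
        by_contra hne
        refine hsep y (u⁻¹ * w) (Finset.mem_erase.2 ⟨hne, ?_⟩) hy (by rwa [mul_smul])
        exact Finset.mul_mem_mul
          (Finset.inv_mem_inv (Finset.mem_biUnion.2 ⟨j', Finset.mem_range.2 hj', hu⟩))
          (Finset.mem_biUnion.2 ⟨j, Finset.mem_range.2 hj, hw⟩)
      obtain rfl : u = w := inv_mul_eq_one.1 hwu
      obtain rfl := hR hu hw
      simpa using hb'
    · obtain ⟨w, hw, hMw⟩ := hMW (g j • y)
      refine ⟨w * g j, hRW.2 ⟨w, hw, rfl⟩, j, hj, w * g j, hRW.2 ⟨w, hw, rfl⟩, ?_, ?_, ?_⟩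
      · rwa [mul_smul]
      · rwa [inv_smul_smul]
      · rwa [inv_smul_smul]

/-- Parameters for the coding of all levels. -/
theorem exists_levelData_seq [Infinite Γ] (g : ℕ → Γ) (hg : ∀ i, g i ≠ 1) (W : Finset Γ) :
    ∃ (p : ℕ → LevelData Γ) (V : ℕ → Finset Γ), V 0 = W ∧ (∀ i, V (i + 1) = (p i).W) ∧
      ∀ i, (p i).Codes (g i) (V i) := by
  choose P hP using fun i (W : Finset Γ) => exists_levelData (hg i) W
  let V : ℕ → Finset Γ := fun i => Nat.rec W (fun i V => (P i V).W) i
  exact ⟨fun i => P i (V i), V, rfl, fun i => rfl, fun i => hP i (V i)⟩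

theorem exists_isTower {g : ℕ → Γ} {p : ℕ → LevelData Γ} {V : ℕ → Finset Γ}
    (hV : ∀ i, V (i + 1) = (p i).W) (hp : ∀ i, (p i).Codes (g i) (V i))
    {Y : Type} [MulAction Γ Y] [TopologicalSpace Y] [ContinuousConstSMul Γ Y]
    {κ : Y → ℕ} (hκc : IsLocallyConstant κ) (n i : ℕ)
    (hκ : ∀ j, i ≤ j → j < i + n → ∀ y, ∀ σ ∈ (p j).F, κ (σ • y) ≠ κ y)
    {M : Y → Prop} (hM : IsLocallyConstant M) (hMV : ∀ y, ∃ w ∈ V i, M (w • y)) :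
    ∃ S : MarkerState Y, IsLocallyConstant S.q ∧ IsLocallyConstant S.d ∧ (∀ y, S.q y → M y) ∧
      (∀ y, S.d y → M y) ∧ IsTower g p n i S := by
  induction n generalizing i M with
  | zero =>
    exact ⟨⟨fun _ => False, fun _ => False⟩, IsLocallyConstant.const _, IsLocallyConstant.const _,
      fun _ => False.elim, fun _ => False.elim, trivial⟩
  | succ n ih =>
    obtain ⟨M', c, hM'c, hcc, hM'M, hM'W, hc, hb⟩ :=
      (hp i).2 Y κ hκc (hκ i le_rfl (by omega)) M hM hMV
    obtain ⟨T, hTq, hTd, hTqM, hTdM, hT⟩ := ih (i + 1)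
      (fun j hj hj' => hκ j (by omega) (by omega)) hM'c (by rwa [hV])
    let b : ℕ → Y → Prop
      | 0 => T.q
      | 1 => T.d
      | j + 2 => c j
    obtain ⟨d, hdc, hdM, hd⟩ := hb b fun j => match j with
      | 0 => hTq
      | 1 => hTd
      | j + 2 => hcc j
    refine ⟨⟨M', d⟩, hM'c, hdc, hM'M, hdM, ⟨hM'W, fun y w hw h1 h2 => ?_⟩, ?_⟩
    · obtain ⟨j, hj, hne⟩ := hc y w hw h1 h2
      refine ⟨j, hj, ?_⟩
      rwa [hd _ h1 _ (by omega), hd _ h2 _ (by omega)]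
    · have : MarkerState.next (p i).R ⟨M', d⟩ = T := by
        ext y
        · exact ⟨fun h => (hd y h.1 0 (by omega)).1 h.2,
            fun h => ⟨hTqM y h, (hd y (hTqM y h) 0 (by omega)).2 h⟩⟩
        · exact ⟨fun h => (hd y h.1 1 (by omega)).1 h.2,
            fun h => ⟨hTdM y h, (hd y (hTdM y h) 1 (by omega)).2 h⟩⟩
      rwa [this]

end Coding

section Base

variable {Γ : Type} [Group Γ]

theorem exists_sidon (Γ : Type) [Group Γ] [Infinite Γ] : ∃ s : ℕ → Γ, Function.Injective s ∧
    ∀ σ : Γ, σ ≠ 1 → ∀ I : Finset ℕ, (∀ i ∈ I, ∃ j, s i * σ = s j) → I.card ≤ 2 := by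
  classical
  choose g hg using fun E : Finset Γ => Infinite.exists_notMem_finset (E * E⁻¹ * E)
  let E : ℕ → Finset Γ := fun n => Nat.rec ∅ (fun _ E => insert (g E) E) n
  let s : ℕ → Γ := fun n => g (E n)
  have hE : ∀ n, E (n + 1) = insert (s n) (E n) := fun _ => rfl
  have hmem : ∀ {j n}, j < n → s j ∈ E n := by
    intro j n hjn
    induction n with
    | zero => omega
    | succ n ih =>
      rw [hE]
      rcases Nat.lt_succ_iff_lt_or_eq.1 hjn with h | rfl
      · exact Finset.mem_insert_of_mem (ih h)
      · exact Finset.mem_insert_self _ _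
  have hs : ∀ {a b c n}, a < n → b < n → c < n → s n ≠ s a * (s b)⁻¹ * s c := by
    intro a b c n ha hb hc e
    refine hg (E n) ?_
    change s n ∈ _
    rw [e]
    exact Finset.mul_mem_mul (Finset.mul_mem_mul (hmem ha) (Finset.inv_mem_inv (hmem hb))) (hmem hc)
  have hinj : Function.Injective s := by
    intro a b hab
    rcases lt_trichotomy a b with h | h | h
    · exact absurd (by simpa using hab.symm) (hs h h h)
    · exact h
    · exact absurd (by simpa using hab) (hs h h h)
  have key : ∀ {σ : Γ} {i j i' j'}, i < j → i' < j' → s i * σ = s j → s i' * σ = s j' → j ≤ j' := by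
    intro σ i j i' j' hij hij' e e'
    by_contra! hlt
    refine hs (a := i) (b := i') (c := j') hij (hij'.trans hlt) hlt ?_
    rw [← e, ← e', mul_assoc, inv_mul_cancel_left]
  have uniq : ∀ {σ : Γ} {i j i' j'}, i < j → i' < j' → s i * σ = s j → s i' * σ = s j' →
      i = i' ∧ j = j' := by
    intro σ i j i' j' hij hij' e e'
    obtain rfl := le_antisymm (key hij hij' e e') (key hij' hij e' e)
    exact ⟨hinj (mul_right_cancel (e.trans e'.symm)), rfl⟩
  refine ⟨s, hinj, fun σ hσ I hI => ?_⟩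
  choose! t ht using hI
  rw [← Finset.card_filter_add_card_filter_not (fun i => i < t i)]
  refine add_le_add (b := 1) (d := 1) (Finset.card_le_one.2 fun i hi i' hi' => ?_)
    (Finset.card_le_one.2 fun i hi i' hi' => ?_)
  · simp only [Finset.mem_filter] at hi hi'
    exact (uniq hi.2 hi'.2 (ht i hi.1) (ht i' hi'.1)).1
  · simp only [Finset.mem_filter, not_lt] at hi hi'
    have hlt : ∀ i ∈ I, t i ≤ i → t i < i := by
      intro i hi hle
      refine lt_of_le_of_ne hle fun e => hσ ?_
      have := ht i hi
      rwa [e, mul_eq_left] at this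
    have hinv : ∀ i ∈ I, s (t i) * σ⁻¹ = s i := fun i hi => by rw [← ht i hi, mul_inv_cancel_right]
    exact (uniq (hlt i hi.1 hi.2) (hlt i' hi'.1 hi'.2) (hinv i hi.1) (hinv i' hi'.1)).2

/-- The marker state read off from a configuration: all `a • y`, `a ∈ A`, and in addition `tq • y`,
respectively `td • y`, must carry the symbol `o`. -/
def readMark {Y B : Type} [MulAction Γ Y] (A : Finset Γ) (tq td : Γ) (o : B) (χ : Y → B) :
    MarkerState Y :=
  ⟨fun y => (∀ a ∈ A, χ (a • y) = o) ∧ χ (tq • y) = o,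
    fun y => (∀ a ∈ A, χ (a • y) = o) ∧ χ (td • y) = o⟩

theorem exists_base (Γ : Type) [Group Γ] [Infinite Γ] (p₀ : ℕ) :
    ∃ (A : Finset Γ) (tq td : Γ) (V W F : Finset Γ), V.Nonempty ∧ (1 : Γ) ∉ F ∧
      ∀ (B : Type) (o z₀ : B), z₀ ≠ o → ∀ (Y : Type) [MulAction Γ Y] [TopologicalSpace Y]
        [ContinuousConstSMul Γ Y] (κ : Y → ℕ), IsLocallyConstant κ →
        (∀ y, ∀ σ ∈ F, κ (σ • y) ≠ κ y) → ∀ v : Y → Option B, IsLocallyConstant v →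
        (∀ z, (V.filter fun a => (v (a • z)).isSome).card ≤ p₀) →
        ∃ M : Y → Prop, IsLocallyConstant M ∧ (∀ y, ∃ w ∈ W, M (w • y)) ∧
          ∀ q d : Y → Prop, IsLocallyConstant q → IsLocallyConstant d → (∀ y, q y → M y) →
            (∀ y, d y → M y) → ∃ χ : Y → B, IsLocallyConstant χ ∧
              (∀ z b, v z = some b → χ z = b) ∧ readMark A tq td o χ = ⟨q, d⟩ := by
  classical
  obtain ⟨s, hinj, hs⟩ := exists_sidon Γ
  let A : Finset Γ := (Finset.range (p₀ + 3)).image s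
  let S : Finset Γ := (Finset.range (p₀ + 5)).image s
  let tq : Γ := s (p₀ + 3)
  let td : Γ := s (p₀ + 4)
  have hAS : A ⊆ S := Finset.image_subset_image (Finset.range_subset_range.2 (by omega))
  have hqS : tq ∈ S := Finset.mem_image_of_mem _ (by simp)
  have hdS : td ∈ S := Finset.mem_image_of_mem _ (by simp)
  have hqA : tq ∉ A := by
    intro h
    obtain ⟨i, hi, e⟩ := Finset.mem_image.1 h
    rw [hinj e] at hi
    simp at hi
  have hdA : td ∉ A := by
    intro h
    obtain ⟨i, hi, e⟩ := Finset.mem_image.1 h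
    rw [hinj e] at hi
    simp at hi
  have hqd : tq ≠ td := fun e => by simpa using hinj e
  obtain ⟨g, hg⟩ := exists_disjoint_translates S
  let Ω : Finset Γ := (Finset.range (p₀ + 1)).image g
  let V : Finset Γ := S * Ω ∪ A
  let F : Finset Γ := (S⁻¹ * (S * S⁻¹) * S).erase 1
  have hF : ∀ σ ∈ F, σ⁻¹ ∈ F := by
    intro σ hσ
    obtain ⟨h1, h2⟩ := Finset.mem_erase.1 hσ
    refine Finset.mem_erase.2 ⟨inv_ne_one.2 h1, ?_⟩
    have := Finset.inv_mem_inv h2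
    rwa [mul_inv_rev, mul_inv_rev, mul_inv_rev, inv_inv, ← mul_assoc] at this
  refine ⟨A, tq, td, V, insert 1 F * Ω, F, ⟨s 0, ?_⟩, Finset.notMem_erase _ _, ?_⟩
  · exact Finset.mem_union_right _ (Finset.mem_image_of_mem _ (by simp))
  intro B o z₀ hoz Y _ _ _ κ hκc hκ v hv hV
  have hM₀ : IsLocallyConstant fun y => ∀ t ∈ S, v (t • y) = none := by
    rw [IsLocallyConstant.iff_eventually_eq]
    intro y
    filter_upwards [hv.eventually_smul_eq S y] with z hz
    exact propext (forall₂_congr fun t ht => by rw [hz t ht])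
  obtain ⟨M, hMc, hM0, hsep, hmax⟩ := exists_maximal_separated hκc F hF hκ hM₀
  have hsep' : ∀ {m a b c d}, a ∈ S → b ∈ S → c ∈ S → d ∈ S → M m →
      M ((a⁻¹ * (b * c⁻¹) * d) • m) → a⁻¹ * (b * c⁻¹) * d = 1 := by
    intro m a b c d ha hb hc hd h1 h2
    by_contra hne
    refine hsep m _ (Finset.mem_erase.2 ⟨hne, ?_⟩) h1 h2
    exact Finset.mul_mem_mul (Finset.mul_mem_mul (Finset.inv_mem_inv ha)
      (Finset.mul_mem_mul hb (Finset.inv_mem_inv hc))) hd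
  refine ⟨M, hMc, fun y => ?_, fun q d hqc hdc hqM hdM => ?_⟩
  · have : ∃ w ∈ Ω, ∀ t ∈ S, v (t • w • y) = none := by
      by_contra! hcon
      have h2 : ∀ i < p₀ + 1, ∃ t ∈ S, v (t • g i • y) ≠ none := fun i hi =>
        hcon (g i) (Finset.mem_image_of_mem _ (Finset.mem_range.2 hi))
      choose! t htS ht using h2
      have hle : (Finset.range (p₀ + 1)).card ≤
          (V.filter fun a => (v (a • y)).isSome).card := by
        refine Finset.card_le_card_of_injOn (fun i => t i * g i) (fun i hi => ?_)
          fun i hi j hj e => ?_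
        · simp only [Finset.coe_range, Set.mem_Iio] at hi
          simp only [Finset.coe_filter, Set.mem_ofPred_eq]
          refine ⟨Finset.mem_union_left _ (Finset.mul_mem_mul (htS i hi)
            (Finset.mem_image_of_mem _ (Finset.mem_range.2 hi))), ?_⟩
          rw [mul_smul]
          exact Option.isSome_iff_ne_none.2 (ht i hi)
        · simp only [Finset.coe_range, Set.mem_Iio] at hi hj
          by_contra hij
          exact hg i j hij _ (htS i hi) _ (htS j hj) e
      have := hle.trans (hV y)
      simp at this
    obtain ⟨w, hw, hw0⟩ := this
    rcases hmax _ hw0 with h | ⟨σ, hσ, h⟩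
    · exact ⟨w, by simpa using Finset.mul_mem_mul (Finset.mem_insert_self 1 F) hw, h⟩
    · exact ⟨σ * w, Finset.mul_mem_mul (Finset.mem_insert_of_mem hσ) hw, by rwa [mul_smul]⟩
  let P : Y → Prop := fun y => (∃ a ∈ A, M (a⁻¹ • y)) ∨ q (tq⁻¹ • y) ∨ d (td⁻¹ • y)
  let pick : Option B → Prop → B := fun x p => x.getD (if p then o else z₀)
  let χ : Y → B := fun y => pick (v y) (P y)
  have hPc : IsLocallyConstant P := by
    rw [IsLocallyConstant.iff_eventually_eq]
    intro y
    filter_upwards [hMc.eventually_inv_smul_eq A y, hqc.eventually_inv_smul_eq {tq} y,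
      hdc.eventually_inv_smul_eq {td} y] with z h1 h2 h3
    simp only [Finset.mem_singleton, forall_eq] at h2 h3
    simp only [P, h2, h3]
    exact propext (or_congr_left (exists_congr fun a => and_congr_right fun ha => by rw [h1 a ha]))
  have hχc : IsLocallyConstant χ := hv.comp₂ hPc pick
  have hPo : ∀ {y}, v y = none → (χ y = o ↔ P y) := by
    intro y hy
    simp [χ, pick, hy, hoz]
  have hPM : ∀ {y}, P y → ∃ t ∈ S, M (t⁻¹ • y) := by
    rintro y (⟨a, ha, h⟩ | h | h)
    · exact ⟨a, hAS ha, h⟩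
    · exact ⟨tq, hqS, hqM _ h⟩
    · exact ⟨td, hdS, hdM _ h⟩
  have hself : ∀ {z t u}, M z → t ∈ S → u ∈ S → M (u⁻¹ • t • z) → t = u := by
    intro z t u hz ht hu h
    have := hsep' (a := u) (b := t) (c := t) (d := t) hu ht ht ht hz (by simpa [mul_smul] using h)
    rw [mul_inv_cancel, mul_one, inv_mul_eq_one] at this
    exact this.symm
  have hMA : ∀ {z}, M z → ∀ a ∈ A, χ (a • z) = o := fun {z} hz a ha =>
    (hPo (hM0 z hz a (hAS ha))).2 (Or.inl ⟨a, ha, by rwa [inv_smul_smul]⟩)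
  have hAM : ∀ {z}, (∀ a ∈ A, χ (a • z) = o) → M z := by
    intro z hz
    by_contra hMz
    let I := (Finset.range (p₀ + 3)).filter fun i => v (s i • z) = none
    have hI : ∀ i ∈ I, ∃ t ∈ S, M (t⁻¹ • s i • z) := fun i hi => by
      obtain ⟨hi1, hi2⟩ := Finset.mem_filter.1 hi
      exact hPM ((hPo hi2).1 (hz _ (Finset.mem_image_of_mem _ hi1)))
    have hcardI : I.card ≤ 2 := by
      rcases I.eq_empty_or_nonempty with h | ⟨i₀, hi₀⟩
      · simp [h]
      obtain ⟨t₀, ht₀, hM₀⟩ := hI i₀ hi₀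
      refine hs ((s i₀)⁻¹ * t₀) (fun e => hMz ?_) I fun i hi => ?_
      · rw [inv_mul_eq_one] at e
        rwa [e, inv_smul_smul] at hM₀
      · obtain ⟨t, ht, hMt⟩ := hI i hi
        have hsS : ∀ {i}, i ∈ I → s i ∈ S := fun hi =>
          hAS (Finset.mem_image_of_mem _ (Finset.mem_filter.1 hi).1)
        have := hsep' (a := t) (b := s i) (c := s i₀) (d := t₀) ht (hsS hi) (hsS hi₀) ht₀ hM₀
          (by simpa [mul_smul] using hMt)
        obtain ⟨j, -, hj⟩ := Finset.mem_image.1 ht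
        refine ⟨j, ?_⟩
        rw [hj, ← mul_assoc]
        rwa [mul_assoc, inv_mul_eq_one, eq_comm] at this
    have hcardP : ((Finset.range (p₀ + 3)).filter fun i => ¬ v (s i • z) = none).card ≤ p₀ := by
      refine le_trans (Finset.card_le_card_of_injOn s (fun i hi => ?_) hinj.injOn) (hV z)
      simp only [Finset.coe_filter, Set.mem_ofPred_eq] at hi ⊢
      exact ⟨Finset.mem_union_right _ (Finset.mem_image_of_mem _ hi.1),
        Option.isSome_iff_ne_none.2 hi.2⟩
    have := Finset.card_filter_add_card_filter_not (s := Finset.range (p₀ + 3))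
      (fun i => v (s i • z) = none)
    rw [Finset.card_range] at this
    change I.card + _ = _ at this
    omega
  refine ⟨χ, hχc, fun z b h => by simp [χ, pick, h], ?_⟩
  ext z
  · refine ⟨fun ⟨h1, h2⟩ => ?_, fun h => ⟨hMA (hqM z h), ?_⟩⟩
    · have hz := hAM h1
      rcases (hPo (hM0 z hz tq hqS)).1 h2 with ⟨a, ha, h⟩ | h | h
      · exact absurd ((hself hz hqS (hAS ha) h) ▸ ha) hqA
      · rwa [inv_smul_smul] at h
      · exact absurd (hself hz hqS hdS (hdM _ h)) hqd
    · exact (hPo (hM0 z (hqM z h) tq hqS)).2 (Or.inr (Or.inl (by rwa [inv_smul_smul])))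
  · refine ⟨fun ⟨h1, h2⟩ => ?_, fun h => ⟨hMA (hdM z h), ?_⟩⟩
    · have hz := hAM h1
      rcases (hPo (hM0 z hz td hdS)).1 h2 with ⟨a, ha, h⟩ | h | h
      · exact absurd ((hself hz hdS (hAS ha) h) ▸ ha) hdA
      · exact absurd (hself hz hdS hqS (hqM _ h)) hqd.symm
      · rwa [inv_smul_smul] at h
    · exact (hPo (hM0 z (hdM z h) td hdS)).2 (Or.inr (Or.inr (by rwa [inv_smul_smul])))

end Base

section Plant

variable {Γ : Type} [Group Γ]

/-- Patterns `pat j` on `P j` can be planted around all isolated points with label `j`, so that every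
translate of `V` meets at most one planted pattern. -/
theorem exists_plant [DecidableEq Γ] {V : Finset Γ} (hV : V.Nonempty) {J B Y : Type} [Finite J]
    [MulAction Γ Y] [TopologicalSpace Y] [ContinuousConstSMul Γ Y] {p₀ : ℕ} (P : J → Finset Γ)
    (hP : ∀ j, (P j).card ≤ p₀) (pat : J → Γ → B) {lab : Y → Option J}
    (hlab : IsLocallyConstant lab) :
    ∃ v : Y → Option B, IsLocallyConstant v ∧
      (∀ z, (V.filter fun a => (v (a • z)).isSome).card ≤ p₀) ∧
      ∀ y j, lab y = some j →
        (∀ j', ∀ σ ∈ (P j')⁻¹ * V * V⁻¹ * P j, σ ≠ 1 → lab (σ • y) ≠ some j') →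
        ∀ a ∈ P j, v (a • y) = some (pat j a) := by
  classical
  let Q : J → Y → Prop := fun j y => lab y = some j ∧
    ∀ j', ∀ σ ∈ (P j')⁻¹ * V * V⁻¹ * P j, σ ≠ 1 → lab (σ • y) ≠ some j'
  have hQc : ∀ j, IsLocallyConstant (Q j) := by
    intro j
    rw [IsLocallyConstant.iff_eventually_eq]
    intro y
    filter_upwards [hlab.eventually_eq y, Filter.eventually_all.2 fun j' =>
      hlab.eventually_smul_eq ((P j')⁻¹ * V * V⁻¹ * P j) y] with z h1 h2
    simp only [Q, h1]
    exact propext (and_congr_right fun _ => forall_congr' fun j' => forall₂_congr fun σ hσ => by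
      rw [h2 j' σ hσ])
  have huniq : ∀ {z : Y} {j j' a a' b b'}, a ∈ V → a' ∈ V → b ∈ P j → b' ∈ P j' →
      Q j (b⁻¹ • a • z) → Q j' (b'⁻¹ • a' • z) → b'⁻¹ * a' = b⁻¹ * a ∧ j = j' := by
    intro z j j' a a' b b' ha ha' hb hb' h h'
    have hmem : b'⁻¹ * a' * a⁻¹ * b ∈ (P j')⁻¹ * V * V⁻¹ * P j :=
      Finset.mul_mem_mul (Finset.mul_mem_mul (Finset.mul_mem_mul (Finset.inv_mem_inv hb') ha')
        (Finset.inv_mem_inv ha)) hb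
    have hone : b'⁻¹ * a' * a⁻¹ * b = 1 := by
      by_contra hne
      refine h.2 j' _ hmem hne ?_
      rw [← h'.1]
      simp [smul_smul, mul_assoc]
    have e : b'⁻¹ * a' = b⁻¹ * a := by
      rw [mul_assoc, mul_eq_one_iff_eq_inv] at hone
      rw [hone, mul_inv_rev, inv_inv]
    refine ⟨e, ?_⟩
    have h1 := h.1
    rw [smul_smul, ← e, ← smul_smul, h'.1] at h1
    exact (Option.some.inj h1).symm
  let R : Y → B → Prop := fun z b => ∃ j, ∃ a ∈ P j, Q j (a⁻¹ • z) ∧ pat j a = b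
  have hRc : IsLocallyConstant R := by
    rw [IsLocallyConstant.iff_eventually_eq]
    intro y
    filter_upwards [Filter.eventually_all.2 fun j => (hQc j).eventually_inv_smul_eq (P j) y]
      with z hz
    ext b
    exact exists_congr fun j => exists_congr fun a => and_congr_right fun ha => by rw [hz j a ha]
  let pick : (B → Prop) → Option B := fun r => if h : ∃ b, r b then some h.choose else none
  have hpick : ∀ {z}, (pick (R z)).isSome → ∃ j, ∃ a ∈ P j, Q j (a⁻¹ • z) := by
    intro z hz
    by_cases h : ∃ b, R z b
    · obtain ⟨b, j, a, ha, hQ, -⟩ := h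
      exact ⟨j, a, ha, hQ⟩
    · simp [pick, h] at hz
  refine ⟨fun z => pick (R z), hRc.comp pick, fun z => ?_, fun y j hj hiso a ha => ?_⟩
  · rcases (V.filter fun a => (pick (R (a • z))).isSome).eq_empty_or_nonempty with h0 | ⟨a₀, ha₀⟩
    · rw [h0]; simp
    obtain ⟨ha₀V, h⟩ := Finset.mem_filter.1 ha₀
    obtain ⟨j, b₀, hb₀, hQ₀⟩ := hpick h
    refine le_trans (Finset.card_le_card_of_injOn (fun a => a * (b₀⁻¹ * a₀)⁻¹) (fun a ha => ?_)
      fun a _ a' _ e => mul_right_cancel e) (hP j)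
    obtain ⟨haV, h⟩ := Finset.mem_filter.1 ha
    obtain ⟨j', b, hb, hQ⟩ := hpick h
    obtain ⟨e, rfl⟩ := huniq ha₀V haV hb₀ hb hQ₀ hQ
    rw [← e]
    simpa using hb
  · have hR : ∀ b, R (a • y) b ↔ pat j a = b := by
      refine fun b => ⟨?_, fun h => ⟨j, a, ha, ?_, h⟩⟩
      · rintro ⟨j', a', ha', hQ', rfl⟩
        obtain ⟨x, hx⟩ := hV
        have hQ : Q j (a⁻¹ • x • x⁻¹ • a • y) := by simpa using ⟨hj, hiso⟩
        obtain ⟨e, rfl⟩ := huniq hx hx ha ha' hQ (by simpa using hQ')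
        rw [inv_injective (mul_right_cancel e)]
      · rw [inv_smul_smul]
        exact ⟨hj, hiso⟩
    have hex : ∃ b, R (a • y) b := ⟨_, (hR _).2 rfl⟩
    simp only [pick, hex, dite_true]
    rw [← (hR _).1 hex.choose_spec]

end Plant

section Scheme

variable {Γ : Type} [Group Γ]

theorem exists_scheme [DecidableEq Γ] [Countable Γ] [Infinite Γ] {k : ℕ} (hk : 2 ≤ k) (p₀ : ℕ) :
    ∃ (V : Finset Γ) (X : ℕ → Set (Γ → Fin k)), (∀ n, IsClosed (X n)) ∧ Antitone X ∧
      (∀ n γ, ∀ x ∈ X n, shiftAct γ x ∈ X n) ∧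
      (∀ x, (∀ n, x ∈ X n) → x ∈ freePart Γ (Fin k)) ∧
      ∀ n, ∃ F : Finset Γ, (1 : Γ) ∉ F ∧ ∀ (Y : Type) [MulAction Γ Y] [TopologicalSpace Y]
        [ContinuousConstSMul Γ Y] (κ : Y → ℕ), IsLocallyConstant κ →
        (∀ y, ∀ σ ∈ F, κ (σ • y) ≠ κ y) →
        ∀ (J : Type) [Finite J] (P : J → Finset Γ), (∀ j, (P j).card ≤ p₀) →
        ∀ (pat : J → Γ → Fin k) (lab : Y → Option J), IsLocallyConstant lab →
        ∃ χ : Y → Fin k, IsLocallyConstant χ ∧ (∀ y, (fun δ : Γ => χ (δ • y)) ∈ X n) ∧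
          ∀ y j, lab y = some j →
            (∀ j', ∀ σ ∈ (P j')⁻¹ * V * V⁻¹ * P j, σ ≠ 1 → lab (σ • y) ≠ some j') →
            ∀ a ∈ P j, χ (a • y) = pat j a := by
  obtain ⟨A, tq, td, V, W, F₀, hV, hF₀, hbase⟩ := exists_base Γ p₀
  obtain ⟨γ₀, hγ₀⟩ := exists_ne (1 : Γ)
  have : Nonempty {γ : Γ // γ ≠ 1} := ⟨⟨γ₀, hγ₀⟩⟩
  obtain ⟨e, he⟩ := exists_surjective_nat {γ : Γ // γ ≠ 1}
  obtain ⟨p, U, hU₀, hU, hp⟩ := exists_levelData_seq (fun i => (e i : Γ)) (fun i => (e i).2) W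
  let o : Fin k := ⟨0, by omega⟩
  let z₀ : Fin k := ⟨1, by omega⟩
  let dec : (Γ → Fin k) → MarkerState Γ := readMark A tq td o
  have hdec : ∀ γ x, dec (shiftAct γ x) = (dec x).comap (· * γ) := by
    intro γ x
    simp [dec, readMark, MarkerState.comap, shiftAct, mul_assoc]
  refine ⟨V, fun n => {x | IsTower (fun i => (e i : Γ)) p n 0 (dec x)}, fun n => ?_,
    antitone_nat_of_succ_le fun n x hx => IsTower.of_succ hx, fun n γ x hx => ?_, fun x hx γ hγ => ?_,
    fun n => ?_⟩
  · have hx : ∀ (γ : Γ), IsLocallyConstant fun x : Γ → Fin k => x γ := fun γ =>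
      (IsLocallyConstant.iff_continuous _).2 (continuous_apply γ)
    have hx' : ∀ (t y : Γ), IsLocallyConstant fun x : Γ → Fin k =>
        (∀ a ∈ A, x (a • y) = o) ∧ x (t • y) = o := by
      intro t y
      rw [IsLocallyConstant.iff_eventually_eq]
      intro x
      filter_upwards [(Filter.eventually_all_finset A).2 fun a _ => (hx (a • y)).eventually_eq x,
        (hx (t • y)).eventually_eq x] with z h1 h2
      rw [h2]
      exact propext (and_congr_left fun _ => forall₂_congr fun a ha => by rw [h1 a ha])
    exact isClosed_isTower n 0 dec (fun y => hx' tq y) (fun y => hx' td y)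
  · change IsTower _ _ _ _ _
    rw [hdec]
    exact IsTower.comap (h := (· * γ)) (fun δ z => by simp [mul_assoc]) hx
  · by_contra hne
    obtain ⟨j, hj⟩ := he ⟨γ, hne⟩
    have hT : IsTower (fun i => (e i : Γ)) p (0 + j + 1) 0 (dec x) := hx (0 + j + 1)
    refine hT.not_period 0 j 0 (dec x) (γ := γ) ?_ (by simp [hj])
    rw [← hdec, hγ]
  · refine ⟨F₀ ∪ (Finset.range n).biUnion fun i => (p i).F, ?_, ?_⟩
    · simp only [Finset.mem_union, Finset.mem_biUnion, not_or, not_exists, not_and]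
      exact ⟨hF₀, fun i _ => (hp i).1⟩
    intro Y _ _ _ κ hκc hκ J _ P hP pat lab hlab
    obtain ⟨v, hvc, hvcard, hv⟩ := exists_plant hV P hP pat hlab
    obtain ⟨M, hMc, hMW, hM⟩ := hbase (Fin k) o z₀ (by simp [o, z₀]) Y κ hκc
      (fun y σ hσ => hκ y σ (Finset.mem_union_left _ hσ)) v hvc hvcard
    obtain ⟨S, hSq, hSd, hSqM, hSdM, hS⟩ := exists_isTower hU hp hκc n 0
      (fun j _ hj y σ hσ => hκ y σ (Finset.mem_union_right _
        (Finset.mem_biUnion.2 ⟨j, Finset.mem_range.2 (by omega), hσ⟩))) hMc (by rwa [hU₀])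
    obtain ⟨χ, hχc, hχv, hχ⟩ := hM S.q S.d hSq hSd hSqM hSdM
    refine ⟨χ, hχc, fun y => ?_, fun y j hj hiso a ha => hχv _ _ (hv y j hj hiso a ha)⟩
    have : dec (fun δ : Γ => χ (δ • y)) = S.comap (· • y) := by
      have h : readMark A tq td o χ = S := hχ
      rw [← h]
      simp [dec, readMark, MarkerState.comap, mul_smul]
    change IsTower _ _ _ _ _
    rw [this]
    exact IsTower.comap (h := (· • y)) (fun δ z => by simp [mul_smul]) hS

end Scheme

section Cylinder

theorem exists_finset_of_mem_isOpen {ι C : Type*} [TopologicalSpace C] {U : Set (ι → C)}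
    (hU : IsOpen U) {x : ι → C} (hx : x ∈ U) :
    ∃ D : Finset ι, ∀ y : ι → C, (∀ i ∈ D, y i = x i) → y ∈ U := by
  obtain ⟨D, u, hu, hsub⟩ := isOpen_pi_iff.1 hU x hx
  exact ⟨D, fun y hy => hsub fun i hi => by rw [hy i hi]; exact (hu i hi).2⟩

/-- A cylinder set is clopen. -/
theorem isClopen_cylinder {ι C : Type*} [TopologicalSpace C] [DiscreteTopology C] (D : Finset ι)
    (x : ι → C) : IsClopen {y : ι → C | ∀ i ∈ D, y i = x i} := by
  have : {y : ι → C | ∀ i ∈ D, y i = x i} = ⋂ i ∈ D, (fun y : ι → C => y i) ⁻¹' {x i} := by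
    ext; simp
  rw [this]
  exact isClopen_biInter_finset fun i _ => (isClopen_discrete _).preimage (continuous_apply i)

/-- `f` is locally constant on `T`. -/
def LocallyDetermined {ι : Type*} {k : ℕ} {C : Type*} (f : (ι → Fin k) → C) (T : Set (ι → Fin k)) :
    Prop :=
  ∀ x ∈ T, ∃ D : Finset ι, ∀ y ∈ T, (∀ δ ∈ D, y δ = x δ) → f y = f x

theorem locallyDetermined_of_continuousOn {ι : Type*} {k : ℕ} {C : Type*} [TopologicalSpace C]
    [DiscreteTopology C] {f : (ι → Fin k) → C} {T : Set (ι → Fin k)} (hf : ContinuousOn f T) :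
    LocallyDetermined f T := by
  intro x hx
  have : f ⁻¹' {f x} ∈ nhdsWithin x T :=
    (hf x hx).preimage_mem_nhdsWithin ((isOpen_discrete _).mem_nhds rfl)
  obtain ⟨U, hU, hxU, hsub⟩ := mem_nhdsWithin.1 this
  obtain ⟨D, hD⟩ := exists_finset_of_mem_isOpen hU hxU
  exact ⟨D, fun y hy hyD => hsub ⟨hD y hyD, hy⟩⟩

/-- A locally constant function on a compact set extends to a locally constant function. -/
theorem LocallyDetermined.exists_extension {ι : Type*} {k : ℕ} {C : Type*} [Nonempty C]
    {f : (ι → Fin k) → C} {K : Set (ι → Fin k)} (hf : LocallyDetermined f K) (hK : IsCompact K) :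
    ∃ g : (ι → Fin k) → C, IsLocallyConstant g ∧ ∀ x ∈ K, g x = f x := by
  classical
  choose! D hD using hf
  obtain ⟨t, htK, ht⟩ := hK.elim_nhds_subcover (fun x => {y | ∀ δ ∈ D x, y δ = x δ})
    fun x _ => (isClopen_cylinder (D x) x).2.mem_nhds fun _ _ => rfl
  let E := t.biUnion D
  have key : ∀ x ∈ K, ∀ y ∈ K, (∀ δ ∈ E, y δ = x δ) → f y = f x := by
    intro x hx y hy hxy
    obtain ⟨z, hz, hxz⟩ := Set.mem_iUnion₂.1 (ht hx)
    rw [hD z (htK z hz) x hx hxz]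
    refine hD z (htK z hz) y hy fun δ hδ => ?_
    rw [hxy δ (Finset.mem_biUnion.2 ⟨z, hz, hδ⟩), hxz δ hδ]
  let pick : Set (ι → Fin k) → C := fun T =>
    if h : T.Nonempty then f h.some else Classical.arbitrary C
  refine ⟨fun x => pick {y ∈ K | ∀ δ ∈ E, y δ = x δ}, ?_, fun x hx => ?_⟩
  · rw [IsLocallyConstant.iff_eventually_eq]
    intro x
    filter_upwards [(isClopen_cylinder E x).2.mem_nhds fun _ _ => rfl] with y hy
    congr 1
    ext z
    exact and_congr_right fun _ => forall₂_congr fun δ hδ => by rw [hy δ hδ]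
  · have h : {y ∈ K | ∀ δ ∈ E, y δ = x δ}.Nonempty := ⟨x, hx, fun _ _ => rfl⟩
    simp only [pick]
    rw [dif_pos h]
    exact key x hx _ h.some_mem.1 h.some_mem.2

end Cylinder

section FreePart

variable {Γ : Type} [Group Γ]

theorem shiftAct_shiftAct {A : Type*} (γ δ : Γ) (x : Γ → A) :
    shiftAct γ (shiftAct δ x) = shiftAct (γ * δ) x := by
  funext ε
  simp [shiftAct, mul_assoc]

theorem shiftAct_mem_freePart {A : Type*} {x : Γ → A} (hx : x ∈ freePart Γ A) (γ : Γ) :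
    shiftAct γ x ∈ freePart Γ A := by
  intro δ hδ
  have := hx (γ⁻¹ * δ * γ) (by
    rw [← shiftAct_shiftAct, ← shiftAct_shiftAct, hδ, shiftAct_shiftAct]
    funext ε
    simp [shiftAct])
  rwa [mul_assoc, inv_mul_eq_one, right_eq_mul] at this

theorem continuous_shiftAct {A : Type*} [TopologicalSpace A] (γ : Γ) :
    Continuous (shiftAct γ : (Γ → A) → Γ → A) :=
  continuous_pi fun δ => continuous_apply (δ * γ)

theorem dense_freePart [Countable Γ] [Infinite Γ] {k : ℕ} (hk : 2 ≤ k) :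
    Dense (freePart Γ (Fin k)) := by
  classical
  have heq : freePart Γ (Fin k) = ⋂ γ : {γ : Γ // γ ≠ 1}, {x | shiftAct γ.1 x ≠ x} := by
    ext x
    simp only [freePart, Set.mem_iInter, Subtype.forall]
    exact ⟨fun h γ hγ e => hγ (h γ e), fun h γ e => by_contra fun hγ => h γ hγ e⟩
  rw [heq]
  refine dense_iInter_of_isOpen (fun γ => ?_) fun γ => ?_
  · exact isOpen_ne_fun (continuous_shiftAct γ.1) continuous_id
  · rw [dense_iff_inter_open]
    rintro U hU ⟨x, hx⟩
    obtain ⟨D, hD⟩ := exists_finset_of_mem_isOpen hU hx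
    obtain ⟨δ, hδ⟩ := Infinite.exists_notMem_finset D
    have : Nontrivial (Fin k) := Fin.nontrivial_iff_two_le.2 hk
    obtain ⟨b, hb⟩ := exists_ne (x (δ * γ))
    refine ⟨Function.update x δ b, hD _ fun i hi => ?_, fun e => hb ?_⟩
    · rw [Function.update_of_ne]
      rintro rfl
      exact hδ hi
    · have := congrFun e δ
      rw [shiftAct, Function.update_self, Function.update_of_ne] at this
      · exact this.symm
      · simpa using γ.2

theorem exists_mem_freePart_of_pattern [Countable Γ] [Infinite Γ] {k : ℕ} (hk : 2 ≤ k)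
    (D : Finset Γ) (p : Γ → Fin k) : ∃ x ∈ freePart Γ (Fin k), ∀ δ ∈ D, x δ = p δ := by
  obtain ⟨x, hx, hx'⟩ := (dense_freePart hk).inter_open_nonempty _ (isClopen_cylinder D p).2
    ⟨p, fun _ _ => rfl⟩
  exact ⟨x, hx', hx⟩

/-- The elements whose action does not change the value of `f` on the free part. -/
def invSet {k : ℕ} {C : Type*} (f : (Γ → Fin k) → C) : Set Γ :=
  {γ | ∀ x ∈ freePart Γ (Fin k), f (shiftAct γ x) = f x}

/-- Patterns forcing `f (γ · x) ≠ f x`. -/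
def Breaks {k : ℕ} {C : Type*} (f : (Γ → Fin k) → C) (γ : Γ) (P : Finset Γ) (p : Γ → Fin k) :
    Prop :=
  ∀ x ∈ freePart Γ (Fin k), (∀ δ ∈ P, x δ = p δ) → f (shiftAct γ x) ≠ f x

theorem exists_breaks [DecidableEq Γ] {k : ℕ} {C : Type*} {f : (Γ → Fin k) → C}
    {x y : Γ → Fin k} {D E : Finset Γ}
    (hD : ∀ z ∈ freePart Γ (Fin k), (∀ δ ∈ D, z δ = x δ) → f z = f x)
    (hE : ∀ z ∈ freePart Γ (Fin k), (∀ δ ∈ E, z δ = y δ) → f z = f y) (hxy : f y ≠ f x) {γ : Γ}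
    {p : Γ → Fin k} (hpD : ∀ δ ∈ D, p δ = x δ) (hpE : ∀ δ ∈ E, p (δ * γ) = y δ) :
    Breaks f γ (D ∪ E * {γ}) p := by
  intro z hz hzp
  rw [hD z hz fun δ hδ => by rw [hzp δ (Finset.mem_union_left _ hδ), hpD δ hδ],
    hE _ (shiftAct_mem_freePart hz γ) fun δ hδ => ?_]
  · exact hxy
  · rw [shiftAct, hzp (δ * γ) (Finset.mem_union_right _
      (Finset.mul_mem_mul hδ (Finset.mem_singleton_self γ))), hpE δ hδ]

theorem exists_breaks_of_notMem [DecidableEq Γ] {k : ℕ} {C : Type*} {f : (Γ → Fin k) → C}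
    (hf : LocallyDetermined f (freePart Γ (Fin k))) {γ : Γ} (hγ : γ ∉ invSet f) :
    ∃ P p, Breaks f γ P p := by
  simp only [invSet, Set.mem_ofPred_eq, not_forall] at hγ
  obtain ⟨x, hx, hne⟩ := hγ
  obtain ⟨D, hD⟩ := hf x hx
  obtain ⟨E, hE⟩ := hf _ (shiftAct_mem_freePart hx γ)
  exact ⟨_, x, exists_breaks hD hE hne (fun _ _ => rfl) fun _ _ => rfl⟩

theorem exists_breaks_of_disjoint [DecidableEq Γ] {k : ℕ} {C : Type*} {f : (Γ → Fin k) → C}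
    {x y : Γ → Fin k} {D : Finset Γ}
    (hx : ∀ z ∈ freePart Γ (Fin k), (∀ δ ∈ D, z δ = x δ) → f z = f x)
    (hy : ∀ z ∈ freePart Γ (Fin k), (∀ δ ∈ D, z δ = y δ) → f z = f y) (hxy : f y ≠ f x) {γ : Γ}
    (hγ : γ ∉ D⁻¹ * D) : ∃ P p, P.card ≤ 2 * D.card ∧ Breaks f γ P p := by
  refine ⟨D ∪ D * {γ}, fun δ => if δ ∈ D then x δ else y (δ * γ⁻¹), ?_,
    exists_breaks hx hy hxy (fun δ hδ => if_pos hδ) fun δ hδ => ?_⟩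
  · refine (Finset.card_union_le _ _).trans ?_
    have := Finset.card_mul_le (s := D) (t := {γ})
    rw [Finset.card_singleton] at this
    omega
  · rw [if_neg, mul_inv_cancel_right]
    intro h
    refine hγ ?_
    have := Finset.mul_mem_mul (Finset.inv_mem_inv hδ) h
    rwa [inv_mul_cancel_left] at this

theorem Breaks.notMem [Countable Γ] [Infinite Γ] {k : ℕ} (hk : 2 ≤ k) {C : Type*}
    {f : (Γ → Fin k) → C} {γ : Γ} {P : Finset Γ} {p : Γ → Fin k} (h : Breaks f γ P p) :
    γ ∉ invSet f := by
  intro hγ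
  obtain ⟨x, hx, hxp⟩ := exists_mem_freePart_of_pattern hk P p
  exact h x hx hxp (hγ x hx)

/-- Uniform bound for the size of the patterns that break the elements outside `invSet f`. -/
theorem exists_breaks_card_le [DecidableEq Γ] {k : ℕ} {C : Type*} {f : (Γ → Fin k) → C}
    (hf : LocallyDetermined f (freePart Γ (Fin k))) {x y : Γ → Fin k} {D : Finset Γ}
    (hx : ∀ z ∈ freePart Γ (Fin k), (∀ δ ∈ D, z δ = x δ) → f z = f x)
    (hy : ∀ z ∈ freePart Γ (Fin k), (∀ δ ∈ D, z δ = y δ) → f z = f y) (hxy : f y ≠ f x) :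
    ∃ p₀, D.card ≤ p₀ ∧ ∀ γ, ∃ (P : Finset Γ) (p : Γ → Fin k), P.card ≤ p₀ ∧
      (γ ∉ invSet f → Breaks f γ P p) := by
  have h : ∀ γ, ∃ (P : Finset Γ) (p : Γ → Fin k), γ ∉ invSet f → Breaks f γ P p := by
    intro γ
    by_cases hγ : γ ∈ invSet f
    · exact ⟨∅, x, fun h => absurd hγ h⟩
    · obtain ⟨P, p, hP⟩ := exists_breaks_of_notMem hf hγ
      exact ⟨P, p, fun _ => hP⟩
  choose P p hP using h
  refine ⟨2 * D.card + (D⁻¹ * D).sup fun γ => (P γ).card, by omega, fun γ => ?_⟩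
  by_cases hγ : γ ∈ D⁻¹ * D
  · exact ⟨P γ, p γ, le_add_left (Finset.le_sup (f := fun γ => (P γ).card) hγ), hP γ⟩
  · obtain ⟨P', p', hcard, hP'⟩ := exists_breaks_of_disjoint hx hy hxy hγ
    exact ⟨P', p', le_add_right hcard, fun _ => hP'⟩

end FreePart

section ColoringSpace

variable {Γ : Type} [Group Γ] {F : Finset Γ} {ℓ : ℕ}

theorem shiftAct_mem_properCol {c : Γ → Fin ℓ} (hc : c ∈ properCol F ℓ) (γ : Γ) :
    shiftAct γ c ∈ properCol F ℓ := by
  intro δ σ hσ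
  simpa [shiftAct, mul_assoc] using hc (δ * γ) σ hσ

instance : MulAction Γ (properCol F ℓ) where
  smul γ c := ⟨shiftAct γ c.1, shiftAct_mem_properCol c.2 γ⟩
  one_smul c := Subtype.ext (funext fun δ => congrArg c.1 (mul_one δ))
  mul_smul γ δ c := Subtype.ext (shiftAct_shiftAct γ δ c.1).symm

theorem coe_smul_properCol (γ : Γ) (c : properCol F ℓ) :
    ((γ • c : properCol F ℓ) : Γ → Fin ℓ) = shiftAct γ c := rfl

instance : ContinuousConstSMul Γ (properCol F ℓ) where
  continuous_const_smul γ :=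
    ((continuous_shiftAct γ).comp continuous_subtype_val).subtype_mk _

theorem isLocallyConstant_apply_properCol (δ : Γ) :
    IsLocallyConstant fun c : properCol F ℓ => c.1 δ :=
  (IsLocallyConstant.iff_continuous _).2 ((continuous_apply δ).comp continuous_subtype_val)

/-- Proper colourings with `|F| + 1` ordinary colours and additional colours `J`, each of which is
used at most once, at prescribed places. -/
theorem exists_mem_properCol_labels [Countable Γ] (hF : ∀ σ ∈ F, σ⁻¹ ∈ F) (hF1 : (1 : Γ) ∉ F)
    {J : Type} (e : Fin ℓ ≃ Fin (F.card + 1) ⊕ J) (L : Γ → Option J)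
    (hL : ∀ δ δ' j, L δ = some j → L δ' = some j → δ = δ') :
    ∃ c ∈ properCol F ℓ, ∀ δ, (e (c δ)).getRight? = L δ := by
  obtain ⟨κ, hκ⟩ := exists_injective_nat Γ
  have hne : ∀ δ : Γ, ∀ σ ∈ F, σ * δ ≠ δ := fun δ σ hσ h => hF1 (by rwa [mul_eq_right.1 h] at hσ)
  obtain ⟨c₀, hc₀, hc, -⟩ := exists_coloring κ F hF fun δ σ hσ h => hne δ σ hσ (hκ h)
  let c' : Γ → Fin (F.card + 1) ⊕ J := fun δ =>
    (L δ).elim (Sum.inl ⟨c₀ δ, Nat.lt_succ_iff.2 (hc₀ δ)⟩) Sum.inr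
  refine ⟨fun δ => e.symm (c' δ), fun δ σ hσ h => ?_, fun δ => ?_⟩
  · have h' : c' δ = c' (σ * δ) := e.symm.injective h
    rcases h1 : L δ with _ | j <;> rcases h2 : L (σ * δ) with _ | j' <;>
      simp only [c', h1, h2, Option.elim, Sum.inl.injEq, Sum.inr.injEq, Fin.mk.injEq,
        reduceCtorEq] at h'
    · exact hc δ σ hσ h'.symm
    · exact hne δ σ hσ (hL _ _ j' h2 (h' ▸ h1))
  · rw [Equiv.apply_symm_apply]
    rcases h1 : L δ with _ | j <;> simp [c', h1]

end ColoringSpace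

section Code

variable {Γ : Type} [Group Γ]

/-- A locally constant function `f` on the free part can be modelled on some space `Col(F, ℓ)`, with
the same set `invSet f`, and such that the induced map into the shift takes values in a given clopen
set. -/
theorem exists_code [Countable Γ] [Infinite Γ] {k m : ℕ} (hk : 2 ≤ k) {C : Set (Γ → Fin m)}
    (hC : IsClopen C) {f : (Γ → Fin k) → Fin m} (hf : LocallyDetermined f (freePart Γ (Fin k)))
    (hfC : ∀ x ∈ freePart Γ (Fin k), (fun δ => f (shiftAct δ x)) ∈ C) :
    ∃ (F : Finset Γ) (ℓ : ℕ) (h : (Γ → Fin ℓ) → Fin m),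
      (∀ σ ∈ F, σ⁻¹ ∈ F) ∧ (1 : Γ) ∉ F ∧ F.card + 1 ≤ ℓ ∧ ContinuousOn h (properCol F ℓ) ∧
      (∀ c ∈ properCol F ℓ, (fun δ => h (shiftAct δ c)) ∈ C) ∧
      (∀ γ ∈ invSet f, ∀ c ∈ properCol F ℓ, h (shiftAct γ c) = h c) ∧
      ∀ γ ∉ invSet f, ∃ c ∈ properCol F ℓ, h (shiftAct γ c) ≠ h c := by
  classical
  obtain ⟨x₀, hx₀, -⟩ := exists_mem_freePart_of_pattern (Γ := Γ) hk ∅ fun _ => ⟨0, by omega⟩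
  by_cases hconst : ∀ x ∈ freePart Γ (Fin k), f x = f x₀
  · refine ⟨∅, 1, fun _ => f x₀, by simp, by simp, by simp, continuousOn_const, fun _ _ => ?_,
      fun _ _ _ _ => rfl, fun γ hγ => absurd (fun x hx => ?_) hγ⟩
    · convert hfC x₀ hx₀ using 2 with δ
      exact (hconst _ (shiftAct_mem_freePart hx₀ δ)).symm
    · rw [hconst x hx, hconst _ (shiftAct_mem_freePart hx γ)]
  push Not at hconst
  obtain ⟨x₁, hx₁, hne⟩ := hconst
  obtain ⟨D₀, hD₀⟩ := hf x₀ hx₀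
  obtain ⟨D₁, hD₁⟩ := hf x₁ hx₁
  let D := D₀ ∪ D₁
  let z : Bool → Γ → Fin k := fun b => if b then x₁ else x₀
  have hz : ∀ b, ∀ x ∈ freePart Γ (Fin k), (∀ δ ∈ D, x δ = z b δ) → f x = f (z b) := by
    rintro (_ | _) x hx hxD
    · exact hD₀ x hx fun δ hδ => hxD δ (Finset.mem_union_left _ hδ)
    · exact hD₁ x hx fun δ hδ => hxD δ (Finset.mem_union_right _ hδ)
  have hzne : f (z true) ≠ f (z false) := hne
  obtain ⟨p₀, hDp, hbreak⟩ := exists_breaks_card_le hf (hz false) (hz true) hzne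
  choose P p hPcard hP using hbreak
  have hfin : (invSet f).Finite := (D⁻¹ * D).finite_toSet.subset fun γ hγ => by
    by_contra h
    obtain ⟨P', p', -, hP'⟩ := exists_breaks_of_disjoint (hz false) (hz true) hzne h
    exact hP'.notMem hk hγ
  obtain ⟨V, X, hXclosed, hXanti, hXshift, hXfree, hX⟩ := exists_scheme (Γ := Γ) hk p₀
  let F₀ : Finset Γ := D⁻¹ * V * V⁻¹ * D
  have hF₀ : ∀ γ, γ⁻¹ ∈ F₀ → γ ∈ F₀ := by
    intro γ hγ
    have := Finset.inv_mem_inv hγ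
    simpa only [F₀, inv_inv, mul_inv_rev, mul_assoc] using this
  have hKf : LocallyDetermined f (⋂ n, X n) := fun x hx => by
    obtain ⟨D, hD⟩ := hf x (hXfree x (Set.mem_iInter.1 hx))
    exact ⟨D, fun y hy => hD y (hXfree y (Set.mem_iInter.1 hy))⟩
  have : Nonempty (Fin m) := ⟨f x₀⟩
  obtain ⟨g, hgc, hg⟩ := hKf.exists_extension (isClosed_iInter hXclosed).isCompact
  have hgs : ∀ γ, IsLocallyConstant fun x : Γ → Fin k => g (shiftAct γ x) := fun γ =>
    hgc.comp_continuous (continuous_shiftAct γ)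
  have hcyl : ∀ (Q : Finset Γ) (q : Γ → Fin k),
      IsLocallyConstant fun x : Γ → Fin k => ∀ δ ∈ Q, x δ = q δ := by
    intro Q q
    rw [IsLocallyConstant.iff_eventually_eq]
    intro x
    filter_upwards [(isClopen_cylinder Q x).2.mem_nhds fun _ _ => rfl] with y hy
    exact propext (forall₂_congr fun δ hδ => by rw [hy δ hδ])
  have hK : ∀ x ∈ ⋂ n, X n, {x | (fun δ => g (shiftAct δ x)) ∈ C ∧
      (∀ γ ∈ hfin.toFinset, g (shiftAct γ x) = g x) ∧
      (∀ b, (∀ δ ∈ D, x δ = z b δ) → g x = f (z b)) ∧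
      ∀ γ ∈ F₀, γ ∉ invSet f → (∀ δ ∈ P γ, x δ = p γ δ) → g (shiftAct γ x) ≠ g x} ∈ nhds x := by
    intro x hx
    have hxfree := hXfree x (Set.mem_iInter.1 hx)
    have hgx : ∀ γ, g (shiftAct γ x) = f (shiftAct γ x) := fun γ =>
      hg _ (Set.mem_iInter.2 fun n => hXshift n γ x (Set.mem_iInter.1 hx n))
    have h1 : ∀ᶠ y in nhds x, (fun δ => g (shiftAct δ y)) ∈ C := by
      refine (continuous_pi fun δ => (hgs δ).continuous).continuousAt.eventually_mem
        (hC.2.mem_nhds ?_)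
      simpa only [hgx] using hfC x hxfree
    filter_upwards [h1, hgc.eventually_eq x,
      (Filter.eventually_all_finset hfin.toFinset).2 fun γ _ => (hgs γ).eventually_eq x,
      Filter.eventually_all.2 fun b => (hcyl D (z b)).eventually_eq x,
      (Filter.eventually_all_finset F₀).2 fun γ _ => (hgs γ).eventually_eq x,
      (Filter.eventually_all_finset F₀).2 fun γ _ => (hcyl (P γ) (p γ)).eventually_eq x]
      with y h1 h2 h3 h4 h5 h6
    refine ⟨h1, fun γ hγ => ?_, fun b hb => ?_, fun γ hγF hγ hyp => ?_⟩
    · rw [h3 γ hγ, h2, hgx, hg x hx]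
      exact hfin.mem_toFinset.1 hγ x hxfree
    · rw [h2, hg x hx]
      exact hz b x hxfree (by rwa [h4 b] at hb)
    · rw [h5 γ hγF, h2, hgx, hg x hx]
      exact hP γ hγ x hxfree (by rwa [h6 γ hγF] at hyp)
  obtain ⟨n, hn⟩ := exists_subset_nhds_of_isCompact hXanti.directed_ge
    (fun n => (hXclosed n).isCompact) hK
  obtain ⟨F', hF'1, hF'⟩ := hX n
  let F := F' ∪ F'⁻¹
  have hF : ∀ σ ∈ F, σ⁻¹ ∈ F := by
    intro σ hσ
    rcases Finset.mem_union.1 hσ with h | h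
    · exact Finset.mem_union_right _ (Finset.inv_mem_inv h)
    · exact Finset.mem_union_left _ (Finset.mem_inv'.1 h)
  have hF1 : (1 : Γ) ∉ F := by
    simpa [F] using hF'1
  let J := Bool ⊕ F₀
  let ℓ := Fintype.card (Fin (F.card + 1) ⊕ J)
  let e : Fin ℓ ≃ Fin (F.card + 1) ⊕ J := (Fintype.equivFin _).symm
  let PJ : J → Finset Γ := Sum.elim (fun _ => D) fun γ => P γ
  let pJ : J → Γ → Fin k := Sum.elim z fun γ => p γ
  let lab : properCol F ℓ → Option J := fun c => (e (c.1 1)).getRight?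
  have hlab : IsLocallyConstant lab :=
    (isLocallyConstant_apply_properCol 1).comp fun i => (e i).getRight?
  obtain ⟨χ, hχc, hχX, hχ⟩ := hF' (properCol F ℓ) (fun c => (c.1 1 : ℕ))
    ((isLocallyConstant_apply_properCol 1).comp fun i => (i : ℕ))
    (fun c σ hσ h => c.2 1 σ (Finset.mem_union_left _ hσ) (by
      rw [coe_smul_properCol, shiftAct, one_mul] at h
      rw [mul_one]
      exact (Fin.ext h).symm))
    J PJ (by rintro (_ | _); exacts [hDp, hPcard _]) pJ lab hlab
  let ρ : properCol F ℓ → Γ → Fin k := fun c δ => χ (δ • c)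
  have hρ : ∀ γ c, ρ (γ • c) = shiftAct γ (ρ c) := by
    intro γ c
    funext δ
    simp [ρ, shiftAct, mul_smul]
  have hρc : Continuous ρ := continuous_pi fun δ =>
    hχc.continuous.comp (continuous_const_smul δ)
  let h : (Γ → Fin ℓ) → Fin m := fun c => if hc : c ∈ properCol F ℓ then g (ρ ⟨c, hc⟩) else f x₀
  have hh : ∀ c : properCol F ℓ, h c = g (ρ c) := fun c => dif_pos c.2
  have hhs : ∀ (γ : Γ) (c : properCol F ℓ), h (shiftAct γ c) = g (shiftAct γ (ρ c)) := by
    intro γ c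
    rw [← hρ, ← hh, coe_smul_properCol]
  refine ⟨F, ℓ, h, hF, hF1, ?_, ?_, fun c hc => ?_, fun γ hγ c hc => ?_, fun γ hγ => ?_⟩
  · simp [ℓ]
  · rw [continuousOn_iff_continuous_domRestrict]
    exact (hgc.continuous.comp hρc).congr fun c => (hh c).symm
  · have := (hn (hχX ⟨c, hc⟩)).1
    convert this using 2 with δ
    exact hhs δ ⟨c, hc⟩
  · have := (hn (hχX ⟨c, hc⟩)).2.1 γ (hfin.mem_toFinset.2 hγ)
    rw [← hhs, ← hh] at this
    exact this
  have hlabs : ∀ {c : properCol F ℓ} {L : Γ → Option J},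
      (∀ δ, (e (c.1 δ)).getRight? = L δ) → ∀ δ : Γ, lab (δ • c) = L δ := by
    intro c L hL δ
    simp only [lab, coe_smul_properCol, shiftAct, one_mul, hL]
  by_cases hγF : γ ∈ F₀
  · let L : Γ → Option J := fun δ => if δ = 1 then some (Sum.inr ⟨γ, hγF⟩) else none
    have hL : ∀ {δ j}, L δ = some j → δ = 1 := by
      intro δ j h
      by_contra hne
      simp [L, hne] at h
    obtain ⟨c, hc, hcL⟩ := exists_mem_properCol_labels hF hF1 e L
      fun δ δ' j h h' => (hL h).trans (hL h').symm
    have hcl := hlabs (c := ⟨c, hc⟩) hcL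
    refine ⟨c, hc, ?_⟩
    have := (hn (hχX ⟨c, hc⟩)).2.2.2 γ hγF hγ fun δ hδ =>
      hχ ⟨c, hc⟩ (Sum.inr ⟨γ, hγF⟩) (by simpa [L] using hcl 1)
        (fun j' σ _ hσ h => hσ (hL (by rwa [hcl] at h))) δ hδ
    rw [← hhs, ← hh] at this
    exact this
  · have hγ1 : γ ≠ 1 := by
      rintro rfl
      refine hγ fun x _ => congrArg f ?_
      funext δ
      simp [shiftAct]
    let L : Γ → Option J := fun δ =>
      if δ = 1 then some (Sum.inl true) else if δ = γ then some (Sum.inl false) else none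
    have hL : ∀ {δ j}, L δ = some j →
        (δ = 1 ∧ j = Sum.inl true) ∨ (δ = γ ∧ j = Sum.inl false) := by
      intro δ j h
      simp only [L] at h
      split_ifs at h with h1 h2
      · exact Or.inl ⟨h1, (Option.some.inj h).symm⟩
      · exact Or.inr ⟨h2, (Option.some.inj h).symm⟩
    obtain ⟨c, hc, hcL⟩ := exists_mem_properCol_labels hF hF1 e L fun δ δ' j h h' => by
      rcases hL h with ⟨h1, h2⟩ | ⟨h1, h2⟩ <;> rcases hL h' with ⟨h3, h4⟩ | ⟨h3, h4⟩
      · exact h1.trans h3.symm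
      · exact Bool.noConfusion (Sum.inl.inj (h2.symm.trans h4))
      · exact Bool.noConfusion (Sum.inl.inj (h2.symm.trans h4))
      · exact h1.trans h3.symm
    have hcl := hlabs (c := ⟨c, hc⟩) hcL
    have h1 := (hn (hχX ⟨c, hc⟩)).2.2.1 true fun δ hδ =>
      hχ ⟨c, hc⟩ (Sum.inl true) (by simpa [L] using hcl 1) (fun j' σ hσ hσ1 h => by
        rw [hcl] at h
        rcases hL h with ⟨h1, -⟩ | ⟨rfl, rfl⟩
        · exact hσ1 h1
        · exact hγF hσ) δ hδ
    have h2 := (hn (hχX (γ • ⟨c, hc⟩))).2.2.1 false fun δ hδ =>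
      hχ (γ • ⟨c, hc⟩) (Sum.inl false) (by rw [hcl]; simp [L, hγ1]) (fun j' σ hσ hσ1 h => by
        rw [smul_smul, hcl] at h
        rcases hL h with ⟨h1, rfl⟩ | ⟨h1, -⟩
        · rw [mul_eq_one_iff_eq_inv] at h1
          rw [h1] at hσ
          exact hγF (hF₀ γ hσ)
        · exact hσ1 (mul_eq_right.1 h1)) δ hδ
    refine ⟨c, hc, fun heq => hzne ?_⟩
    rw [← h1, ← h2]
    change g (ρ ⟨c, hc⟩) = g (ρ (γ • ⟨c, hc⟩))
    rw [hρ, ← hhs, ← hh]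
    exact heq.symm

theorem mem_mapStab_iff {A B : Type*} {π : (Γ → A) → Γ → B} {T : Set (Γ → A)}
    (hT : ∀ x ∈ T, ∀ γ, shiftAct γ x ∈ T) (hπ : EquivariantOn π T) {γ : Γ} :
    γ ∈ mapStab π T ↔
      ∀ δ, ∀ x ∈ T, π (shiftAct (δ * γ * δ⁻¹) x) 1 = π x 1 := by
  have key : ∀ x ∈ T, ∀ δ, π (shiftAct δ x) 1 = π x δ := fun x hx δ => by
    rw [hπ x hx, shiftAct, one_mul]
  refine ⟨fun h δ x hx => ?_, fun h x hx => funext fun δ => ?_⟩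
  · have := congrFun (h _ (hT x hx δ⁻¹)) δ
    rw [shiftAct, ← key _ (hT x hx δ⁻¹), ← key _ (hT x hx δ⁻¹), shiftAct_shiftAct,
      shiftAct_shiftAct] at this
    rw [this]
    congr 2
    funext ε
    simp [shiftAct]
  · have := h δ _ (hT x hx δ)
    rwa [shiftAct_shiftAct, inv_mul_cancel_right, key x hx, key x hx] at this

end Code

/-- Lemma `cont+Stab`.  Let `S ⊆ m^Γ` be an SFT and let
`π : Free(k^Γ) → S` be a continuous `Γ`-equivariant map, `k ≥ 2`.  Then there exist a
finite symmetric set `F ⊂ Γ` with `1 ∉ F`, an integer `ℓ ≥ |F| + 1`, and a continuous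
`Γ`-equivariant map `π̃ : Col(F, ℓ) → S` with `Stab(π̃) = Stab(π)`. -/
theorem stmt4 {Γ : Type} [Group Γ] [Countable Γ] [Infinite Γ]
    (k m : ℕ) (hk : 2 ≤ k) (hm : 1 ≤ m)
    (S : Set (Γ → Fin m)) (hSFT : IsSFT S)
    (π : (Γ → Fin k) → (Γ → Fin m))
    (hπcont : ContinuousOn π (freePart Γ (Fin k)))
    (hπequiv : EquivariantOn π (freePart Γ (Fin k)))
    (hπmem : ∀ x ∈ freePart Γ (Fin k), π x ∈ S) :
    ∃ (F : Finset Γ) (ℓ : ℕ) (πt : (Γ → Fin ℓ) → (Γ → Fin m)),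
      (∀ σ ∈ F, σ⁻¹ ∈ F) ∧ (1 : Γ) ∉ F ∧ F.card + 1 ≤ ℓ ∧
      ContinuousOn πt (properCol F ℓ) ∧
      EquivariantOn πt (properCol F ℓ) ∧
      (∀ x ∈ properCol F ℓ, πt x ∈ S) ∧
      mapStab πt (properCol F ℓ) = mapStab π (freePart Γ (Fin k)) := by
  obtain ⟨C, hC, rfl⟩ := hSFT
  have hfree : ∀ x ∈ freePart Γ (Fin k), ∀ γ, shiftAct γ x ∈ freePart Γ (Fin k) :=
    fun x hx γ => shiftAct_mem_freePart hx γ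
  have hval : ∀ x ∈ freePart Γ (Fin k), (fun δ => π (shiftAct δ x) 1) = π x := fun x hx => by
    funext δ
    rw [hπequiv x hx, shiftAct, one_mul]
  have hone : ∀ {ℓ : ℕ} (x : Γ → Fin ℓ), shiftAct 1 x = x := fun x => by
    funext δ
    simp [shiftAct]
  obtain ⟨F, ℓ, h, hF, hF1, hℓ, hhc, hhC, hinv, hninv⟩ := exists_code hk hC
    (f := fun x => π x 1)
    (locallyDetermined_of_continuousOn ((continuous_apply 1).comp_continuousOn hπcont))
    fun x hx => by
      have := Set.mem_iInter.1 (hπmem x hx) 1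
      rwa [Set.mem_preimage, hone, ← hval x hx] at this
  have hcol : ∀ c ∈ properCol F ℓ, ∀ γ, shiftAct γ c ∈ properCol F ℓ :=
    fun c hc γ => shiftAct_mem_properCol hc γ
  have hequiv : EquivariantOn (fun c δ => h (shiftAct δ c)) (properCol F ℓ) := fun c _ γ => by
    funext δ
    simp only [shiftAct_shiftAct]
    rfl
  refine ⟨F, ℓ, fun c δ => h (shiftAct δ c), hF, hF1, hℓ, ?_, hequiv, fun c hc => ?_, ?_⟩
  · exact continuousOn_pi.2 fun δ => hhc.comp (continuous_shiftAct δ).continuousOn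
      fun c hc => hcol c hc δ
  · refine Set.mem_iInter.2 fun γ => ?_
    rw [Set.mem_preimage, ← hequiv c hc]
    exact hhC _ (hcol c hc γ)
  · ext γ
    rw [mem_mapStab_iff hcol hequiv, mem_mapStab_iff hfree hπequiv]
    refine forall_congr' fun δ => ?_
    simp only [hone]
    refine ⟨fun H => ?_, fun H => hinv _ H⟩
    by_contra hcon
    obtain ⟨c, hc, hne⟩ := hninv _ hcon
    exact hne (H c hc)
end
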